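/- arXiv:2605.24255 — 3 statements merged into one kernel-verified Lean document; each statement's English description precedes it below -/
import Mathlib

section
/- Let n, l ∈ ℕ, let λ be a partition of n with λ'_1 ≤ l ≤ n, and let R be a standard Young tableau of shape λ. Then there exist a weakly decreasing skew shape σ with ℓ(σ) = l and a standard skew Young tableau S of shape σ (so |σ| = n) whose rectification is R, i.e., some sequence of jeu de taquin slides transforms S into R. -/
open scoped Classical

/-- A 0-based box `(i, j)` belongs to the infinite shape with `l` rows
(`l = ⊤` gives the shape `(∞^∞)`, `l = (l₀ : ℕ∞)` gives `(∞^l₀)`).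
Throughout, boxes are 0-based: the paper's box `(i, j)` (with row `i ≥ 1` and
column `j ≥ 1`) corresponds to `(i - 1, j - 1)`. -/
def Box (l : ℕ∞) (b : ℕ × ℕ) : Prop := (b.1 : ℕ∞) < l

/-- `T` is an infinite standard Young tableau of the shape given by `Box l`:
entries are positive integers on the shape (and the junk value `0` off the shape),
`T` is a bijection from the boxes of the shape onto the positive integers, and
`T` is strictly increasing along rows and columns. -/
structure IsSYT (l : ℕ∞) (T : ℕ × ℕ → ℕ) : Prop where
  zero_outside : ∀ b : ℕ × ℕ, ¬ Box l b → T b = 0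
  pos : ∀ b : ℕ × ℕ, Box l b → 0 < T b
  inj : ∀ b c : ℕ × ℕ, Box l b → Box l c → T b = T c → b = c
  surj : ∀ n : ℕ, 0 < n → ∃ b : ℕ × ℕ, Box l b ∧ T b = n
  row_lt : ∀ b : ℕ × ℕ, Box l b → T b < T (b.1, b.2 + 1)
  col_lt : ∀ b : ℕ × ℕ, Box l (b.1 + 1, b.2) → T b < T (b.1 + 1, b.2)

/-- The sliding path of the filling `T` inside the set `D` of boxes, started at the
box `c`: at each step the empty box moves to whichever of the boxes directly below
or directly to the right (among those belonging to `D`) carries the smaller entry;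
if neither belongs to `D`, the path stays put (it has terminated). -/
noncomputable def slideFrom (D : ℕ × ℕ → Prop) (T : ℕ × ℕ → ℕ) (c : ℕ × ℕ) : ℕ → ℕ × ℕ
  | 0 => c
  | n + 1 =>
      let b := slideFrom D T c n
      if D (b.1 + 1, b.2) ∧ D (b.1, b.2 + 1) then
        (if T (b.1 + 1, b.2) < T (b.1, b.2 + 1) then (b.1 + 1, b.2) else (b.1, b.2 + 1))
      else if D (b.1 + 1, b.2) then (b.1 + 1, b.2)
      else if D (b.1, b.2 + 1) then (b.1, b.2 + 1)
      else b

/-- The sliding path `p(T)`, 0-indexed: `slide D T n` is the paper's `p_{n+1}(T)`;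
it lies on the antidiagonal `i + j = n` as long as the path has not terminated. -/
noncomputable def slide (D : ℕ × ℕ → Prop) (T : ℕ × ℕ → ℕ) : ℕ → ℕ × ℕ :=
  slideFrom D T (0, 0)

/-- Jeu de taquin on the set of boxes `D`: the entry `1` in the box `(0,0)` is
deleted, entries slide backwards along the sliding path, and every entry is
decremented by `1`.  A box `b` lies on the sliding path iff
`slide D T (b.1 + b.2) = b`; if moreover the path terminates at `b` (which is only
possible for finite tableaux) the box `b` is vacated (junk value `0`). -/
noncomputable def jdt (D : ℕ × ℕ → Prop) (T : ℕ × ℕ → ℕ) : ℕ × ℕ → ℕ := fun b =>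
  if slide D T (b.1 + b.2) = b then
    (if slide D T (b.1 + b.2 + 1) = b then 0
     else T (slide D T (b.1 + b.2 + 1)) - 1)
  else T b - 1

/-- A 0-based box of the Young diagram of the partition with row lengths `lam`. -/
def YBox (lam : ℕ → ℕ) (b : ℕ × ℕ) : Prop := b.2 < lam b.1

/-- `lam : ℕ → ℕ` (0-based row lengths) is a partition of `n`. -/
structure IsPartition (lam : ℕ → ℕ) (n : ℕ) : Prop where
  antitone : ∀ i : ℕ, lam (i + 1) ≤ lam i
  finite : {b : ℕ × ℕ | YBox lam b}.Finite
  card : {b : ℕ × ℕ | YBox lam b}.ncard = n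

/-- `S` is a (finite) standard Young tableau of shape `lam` with `n` boxes:
a filling of the diagram of `lam` by `1, …, n` (with junk value `0` off the
diagram), strictly increasing along rows and columns. -/
structure IsFinSYT (lam : ℕ → ℕ) (n : ℕ) (S : ℕ × ℕ → ℕ) : Prop where
  zero_outside : ∀ b : ℕ × ℕ, ¬ YBox lam b → S b = 0
  lb : ∀ b : ℕ × ℕ, YBox lam b → 1 ≤ S b
  ub : ∀ b : ℕ × ℕ, YBox lam b → S b ≤ n
  inj : ∀ b c : ℕ × ℕ, YBox lam b → YBox lam c → S b = S c → b = c
  surj : ∀ m : ℕ, 1 ≤ m → m ≤ n → ∃ b : ℕ × ℕ, YBox lam b ∧ S b = m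
  row_lt : ∀ b : ℕ × ℕ, YBox lam (b.1, b.2 + 1) → S b < S (b.1, b.2 + 1)
  col_lt : ∀ b : ℕ × ℕ, YBox lam (b.1 + 1, b.2) → S b < S (b.1 + 1, b.2)

/-- A 0-based box of the skew diagram `λ̂ / ν` (row lengths `lamh` resp. `nu`). -/
def SkewBox (nu lamh : ℕ → ℕ) (b : ℕ × ℕ) : Prop := nu b.1 ≤ b.2 ∧ b.2 < lamh b.1

/-- `λ̂ / ν` is a skew shape with `k` boxes. -/
structure IsSkewShape (nu lamh : ℕ → ℕ) (k : ℕ) : Prop where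
  nu_antitone : ∀ i : ℕ, nu (i + 1) ≤ nu i
  lamh_antitone : ∀ i : ℕ, lamh (i + 1) ≤ lamh i
  le : ∀ i : ℕ, nu i ≤ lamh i
  finite : {b : ℕ × ℕ | SkewBox nu lamh b}.Finite
  card : {b : ℕ × ℕ | SkewBox nu lamh b}.ncard = k

/-- The skew shape `λ̂ / ν` is weakly decreasing: `σ_i ≥ σ_{i+1}` for all rows. -/
def WeaklyDecreasing (nu lamh : ℕ → ℕ) : Prop :=
  ∀ i : ℕ, lamh (i + 1) - nu (i + 1) ≤ lamh i - nu i

/-- `ℓ(λ̂ / ν) = l`: the last (1-based) row containing a box of the skew shape is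
row `l`, i.e. the 0-based row `l - 1`. -/
def SkewHeight (nu lamh : ℕ → ℕ) (l : ℕ) : Prop :=
  nu (l - 1) < lamh (l - 1) ∧ ∀ i : ℕ, l ≤ i → lamh i = nu i

/-- `S` is a standard skew Young tableau of shape `λ̂ / ν` with entries `1, …, k`. -/
structure IsSkewSYT (nu lamh : ℕ → ℕ) (k : ℕ) (S : ℕ × ℕ → ℕ) : Prop where
  zero_outside : ∀ b : ℕ × ℕ, ¬ SkewBox nu lamh b → S b = 0
  lb : ∀ b : ℕ × ℕ, SkewBox nu lamh b → 1 ≤ S b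
  ub : ∀ b : ℕ × ℕ, SkewBox nu lamh b → S b ≤ k
  inj : ∀ b c : ℕ × ℕ, SkewBox nu lamh b → SkewBox nu lamh c → S b = S c → b = c
  surj : ∀ m : ℕ, 1 ≤ m → m ≤ k → ∃ b : ℕ × ℕ, SkewBox nu lamh b ∧ S b = m
  row_lt : ∀ b : ℕ × ℕ, SkewBox nu lamh b → SkewBox nu lamh (b.1, b.2 + 1) →
    S b < S (b.1, b.2 + 1)
  col_lt : ∀ b : ℕ × ℕ, SkewBox nu lamh b → SkewBox nu lamh (b.1 + 1, b.2) →
    S b < S (b.1 + 1, b.2)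

/-- One jeu de taquin slide on standard skew Young tableaux.  A state is a triple
`(ν, λ̂, S)` consisting of the inner shape, the outer shape, and the filling.  The
slide starts at an outer corner `(i, nu i - 1)` of `ν` (a box of `ν` with no box of
`ν` directly to its right or directly below it); the empty box travels along the
sliding path `P` until the path terminates at a box `t`; every box of the path
moves one step backwards along the path (no decrementing); row `i` of `ν` loses a
box and row `t.1` of `λ̂` loses a box. -/
def JdtSlide (x y : (ℕ → ℕ) × (ℕ → ℕ) × (ℕ × ℕ → ℕ)) : Prop :=
  ∃ (i m : ℕ),
    let nu := x.1
    let lamh := x.2.1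
    let S := x.2.2
    let c : ℕ × ℕ := (i, nu i - 1)
    let P := slideFrom (SkewBox nu lamh) S c
    let t := P m
    0 < nu i ∧ nu (i + 1) < nu i ∧
    P (m + 1) = t ∧
    y.1 = (fun r => if r = i then nu i - 1 else nu r) ∧
    y.2.1 = (fun r => if r = t.1 then lamh t.1 - 1 else lamh r) ∧
    y.2.2 = (fun b : ℕ × ℕ =>
      if b = t then 0
      else if c.1 + c.2 ≤ b.1 + b.2 ∧ P (b.1 + b.2 - (c.1 + c.2)) = b then
        S (P (b.1 + b.2 - (c.1 + c.2) + 1))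
      else S b)

theorem sf_right (D : ℕ × ℕ → Prop) (T : ℕ × ℕ → ℕ) (c : ℕ × ℕ) (m u v : ℕ)
    (h : slideFrom D T c m = (u, v)) (h1 : D (u, v + 1))
    (h2 : D (u + 1, v) → T (u, v + 1) ≤ T (u + 1, v)) :
    slideFrom D T c (m + 1) = (u, v + 1) := by
  simp only [slideFrom, h]
  by_cases hd : D (u + 1, v)
  · simp [hd, h1, Nat.not_lt.mpr (h2 hd)]
  · simp [hd, h1]

theorem sf_down (D : ℕ × ℕ → Prop) (T : ℕ × ℕ → ℕ) (c : ℕ × ℕ) (m u v : ℕ)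
    (h : slideFrom D T c m = (u, v)) (h1 : D (u + 1, v))
    (h2 : D (u, v + 1) → T (u + 1, v) < T (u, v + 1)) :
    slideFrom D T c (m + 1) = (u + 1, v) := by
  simp only [slideFrom, h]
  by_cases hd : D (u, v + 1)
  · simp [hd, h1, h2 hd]
  · simp [hd, h1]

theorem sf_stay (D : ℕ × ℕ → Prop) (T : ℕ × ℕ → ℕ) (c : ℕ × ℕ) (m u v : ℕ)
    (h : slideFrom D T c m = (u, v)) (h1 : ¬ D (u + 1, v)) (h2 : ¬ D (u, v + 1)) :
    slideFrom D T c (m + 1) = (u, v) := by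
  simp only [slideFrom, h]
  simp [h1, h2]

/-- The filling with row `r` equal to `x r 0, …, x r (mu r - 1)`, shifted by `nu r`. -/
noncomputable def tab (mu : ℕ → ℕ) (x : ℕ → ℕ → ℕ) (nu : ℕ → ℕ) : ℕ × ℕ → ℕ := fun b =>
  if nu b.1 ≤ b.2 ∧ b.2 < nu b.1 + mu b.1 then x b.1 (b.2 - nu b.1) else 0

noncomputable def stt (mu : ℕ → ℕ) (x : ℕ → ℕ → ℕ) (nu : ℕ → ℕ) :
    (ℕ → ℕ) × (ℕ → ℕ) × (ℕ × ℕ → ℕ) := (nu, fun r => nu r + mu r, tab mu x nu)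

structure RowsOK (n : ℕ) (mu : ℕ → ℕ) (x : ℕ → ℕ → ℕ) : Prop where
  bd : ∀ r j, j < mu r → 1 ≤ x r j ∧ x r j ≤ n
  inj : ∀ r j r' j', j < mu r → j' < mu r' → x r j = x r' j' → r = r' ∧ j = j'
  surj : ∀ m, 1 ≤ m → m ≤ n → ∃ r j, j < mu r ∧ x r j = m
  row : ∀ r j, j + 1 < mu r → x r j < x r (j + 1)

def Pair (mu : ℕ → ℕ) (x : ℕ → ℕ → ℕ) (nu : ℕ → ℕ) (r : ℕ) : Prop :=
  nu (r + 1) ≤ nu r ∧ nu (r + 1) + mu (r + 1) ≤ nu r + mu r ∧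
  ∀ j k, nu r + j = nu (r + 1) + k → k < mu (r + 1) → x r j < x (r + 1) k

def DiscAt (mu nu : ℕ → ℕ) (r : ℕ) : Prop := nu (r + 1) + mu (r + 1) ≤ nu r

theorem DiscAt.pair {mu nu : ℕ → ℕ} {r : ℕ} (x : ℕ → ℕ → ℕ) (h : DiscAt mu nu r) :
    Pair mu x nu r := by
  unfold DiscAt at h
  refine ⟨by omega, by omega, fun j k h1 h2 => by omega⟩

theorem slideA (mu : ℕ → ℕ) (x : ℕ → ℕ → ℕ) (nu nu' : ℕ → ℕ) (r : ℕ)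
    (hp : Pair mu x nu r) (h1 : nu' r = nu r + 1) (h2 : ∀ s, s ≠ r → nu' s = nu s) :
    JdtSlide (stt mu x nu') (stt mu x nu) := by
  obtain ⟨ha, hb, hc⟩ := hp
  have e1 : nu' (r + 1) = nu (r + 1) := h2 _ (by omega)
  have hP : ∀ m, slideFrom (SkewBox nu' (fun r => nu' r + mu r)) (tab mu x nu')
      (r, nu r) m = (r, nu r + min m (mu r)) := by
    intro m
    induction m with
    | zero => simp [slideFrom]
    | succ m ih =>
      by_cases hm : m < mu r
      · rw [min_eq_left (by omega)] at ih
        rw [min_eq_left (by omega)]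
        refine sf_right _ _ _ _ _ (nu r + m) ih ?_ ?_
        · simp only [SkewBox]; omega
        · simp only [SkewBox, tab]
          rintro ⟨h3, h4⟩
          rw [if_pos (by omega), if_pos (by omega)]
          have := hc m (nu r + m - nu (r + 1)) (by omega) (by omega)
          rw [e1]
          rw [show nu r + m + 1 - nu' r = m by omega]
          omega
      · rw [min_eq_right (by omega)] at ih
        rw [min_eq_right (by omega)]
        refine sf_stay _ _ _ _ _ _ ih ?_ ?_
        · simp only [SkewBox]; omega
        · simp only [SkewBox]; omega
  refine ⟨r, mu r, ?_⟩
  have e2 : nu' r - 1 = nu r := by omega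
  simp only [stt, e2, hP]
  refine ⟨by omega, by omega, by simp, ?_, ?_, ?_⟩
  · funext s
    by_cases hs : s = r
    · simp [hs]
    · simp [hs, h2 s hs]
  · funext s
    by_cases hs : s = r
    · simp [hs]; omega
    · simp [hs, h2 s hs]
  · funext ⟨u, v⟩
    simp only [tab, Prod.mk.injEq]
    by_cases hu : u = r
    · subst hu
      rcases lt_trichotomy v (nu u + mu u) with hv | hv | hv
      · by_cases hv2 : nu u ≤ v
        · have q1 : min (u + v - (u + nu u)) (mu u) = v - nu u := by omega
          have q2 : min (u + v - (u + nu u) + 1) (mu u) = v - nu u + 1 := by omega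
          rw [if_pos (by omega), if_neg (by omega), if_pos (by omega), if_pos (by omega)]
          congr 1; omega
        · rw [if_neg (by omega), if_neg (by omega), if_neg (by omega), if_neg (by omega)]
      · rw [if_neg (by omega), if_pos (by omega)]
      · rw [if_neg (by omega), if_neg (by omega), if_neg (by omega), if_neg (by omega)]
    · have := h2 u hu
      simp only [this]
      rw [if_neg (c := u = r ∧ _) (by omega), if_neg (c := _ ∧ _ ∧ _) (by omega)]

/-- Rows after moving the entry with index `p` of row `i` to index `q` of row `i + 1`. -/
def mv (x : ℕ → ℕ → ℕ) (i p q : ℕ) : ℕ → ℕ → ℕ := fun r j =>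
  if r = i then (if j < p then x i j else x i (j + 1))
  else if r = i + 1 then
    (if j < q then x (i + 1) j else if j = q then x i p else x (i + 1) (j - 1))
  else x r j

theorem mv_a (x : ℕ → ℕ → ℕ) (i p q j : ℕ) (h : j < p) : mv x i p q i j = x i j := by
  simp [mv, h]

theorem mv_b (x : ℕ → ℕ → ℕ) (i p q j : ℕ) (h : p ≤ j) : mv x i p q i j = x i (j + 1) := by
  simp [mv, Nat.not_lt.mpr h]

theorem mv_c (x : ℕ → ℕ → ℕ) (i p q j : ℕ) (h : j < q) :
    mv x i p q (i + 1) j = x (i + 1) j := by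
  simp [mv, h]

theorem mv_d (x : ℕ → ℕ → ℕ) (i p q : ℕ) : mv x i p q (i + 1) q = x i p := by
  simp [mv]

theorem mv_e (x : ℕ → ℕ → ℕ) (i p q j : ℕ) (h : q ≤ j) :
    mv x i p q (i + 1) (j + 1) = x (i + 1) j := by
  have h1 : ¬ j + 1 < q := by omega
  have h2 : ¬ j + 1 = q := by omega
  simp [mv, h1, h2]

theorem mv_f (x : ℕ → ℕ → ℕ) (i p q r j : ℕ) (h : r ≠ i) (h' : r ≠ i + 1) :
    mv x i p q r j = x r j := by
  simp [mv, h, h']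

theorem tab_at (mu : ℕ → ℕ) (x : ℕ → ℕ → ℕ) (nu : ℕ → ℕ) (r c j : ℕ)
    (h : c = nu r + j) (hj : j < mu r) : tab mu x nu (r, c) = x r j := by
  subst h
  simp [tab, hj]

theorem tab_out (mu : ℕ → ℕ) (x : ℕ → ℕ → ℕ) (nu : ℕ → ℕ) (r c : ℕ)
    (h : c < nu r ∨ nu r + mu r ≤ c) : tab mu x nu (r, c) = 0 := by
  simp only [tab]
  rw [if_neg (by omega)]

theorem slideB (mu mu' : ℕ → ℕ) (x : ℕ → ℕ → ℕ) (nu nu' : ℕ → ℕ) (i p q : ℕ)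
    (hp : Pair mu x nu i) (hd : DiscAt mu nu (i + 1))
    (hrow : ∀ j, j + 1 < mu i → x i j < x i (j + 1))
    (h1 : nu' i = nu i + 1) (h2 : ∀ s, s ≠ i → nu' s = nu s)
    (m1 : mu' i + 1 = mu i) (m2 : mu' (i + 1) = mu (i + 1) + 1)
    (m3 : ∀ s, s ≠ i → s ≠ i + 1 → mu' s = mu s)
    (hpq : nu i + p = nu (i + 1) + q) (hpa : p < mu i) (hqb : q ≤ mu (i + 1)) :
    JdtSlide (stt mu' (mv x i p q) nu') (stt mu x nu) := by
  obtain ⟨ha, hb, hc⟩ := hp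
  unfold DiscAt at hd
  have e1 : nu' (i + 1) = nu (i + 1) := h2 _ (by omega)
  have e3 : nu' (i + 1 + 1) = nu (i + 1 + 1) := h2 _ (by omega)
  have e4 : mu' (i + 1 + 1) = mu (i + 1 + 1) := m3 _ (by omega) (by omega)
  obtain ⟨E, hE⟩ : ∃ E, E = nu (i + 1) + mu (i + 1) := ⟨_, rfl⟩
  obtain ⟨P, hPd⟩ : ∃ P, P = slideFrom (SkewBox nu' (fun r => nu' r + mu' r))
    (tab mu' (mv x i p q) nu') (i, nu i) := ⟨_, rfl⟩
  have P1 : ∀ m, m ≤ p → P m = (i, nu i + m) := by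
    intro m
    induction m with
    | zero => intro _; rw [hPd]; rfl
    | succ m ih =>
      intro hm
      have ih := ih (by omega)
      rw [hPd] at ih ⊢
      refine sf_right _ _ _ _ _ (nu i + m) ih ?_ ?_
      · simp only [SkewBox]; omega
      · rintro ⟨h3, h4⟩
        simp only at h3 h4
        rw [tab_at _ _ _ _ _ m (by omega) (by omega),
          tab_at _ _ _ _ _ (nu i + m - nu (i + 1)) (by omega) (by omega),
          mv_a _ _ _ _ _ (by omega), mv_c _ _ _ _ _ (by omega)]
        exact (hc _ _ (by omega) (by omega)).le
  have P2 : ∀ k, P (p + 1 + k) = (i + 1, min (nu i + p + k) E) := by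
    intro k
    induction k with
    | zero =>
      have ih := P1 p le_rfl
      rw [min_eq_left (by omega)]
      rw [hPd] at ih ⊢
      refine sf_down _ _ _ _ _ (nu i + p) ih ?_ ?_
      · simp only [SkewBox]; omega
      · rintro ⟨h3, h4⟩
        simp only at h3 h4
        rw [tab_at _ _ _ _ _ q (by omega) (by omega),
          tab_at _ _ _ _ _ p (by omega) (by omega), mv_d, mv_b _ _ _ _ _ le_rfl]
        exact hrow _ (by omega)
    | succ k ih =>
      by_cases hm2 : nu i + p + k < E
      · rw [min_eq_left (by omega)] at ih
        rw [min_eq_left (by omega)]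
        rw [hPd] at ih ⊢
        refine sf_right _ _ _ _ _ (nu i + p + k) ih ?_ ?_
        · simp only [SkewBox]; omega
        · simp only [SkewBox]
          rintro ⟨h3, h4⟩
          omega
      · rw [min_eq_right (by omega)] at ih
        rw [min_eq_right (by omega)]
        rw [hPd] at ih ⊢
        refine sf_stay _ _ _ _ _ _ ih ?_ ?_
        · simp only [SkewBox]; omega
        · simp only [SkewBox]; omega
  refine ⟨i, p + 1 + (E - (nu i + p)), ?_⟩
  have e2 : nu' i - 1 = nu i := by omega
  simp only [stt, e2]
  rw [← hPd, P2, Nat.add_assoc (p + 1) _ 1, P2]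
  rw [show min (nu i + p + (E - (nu i + p))) E = E by omega,
    show min (nu i + p + (E - (nu i + p) + 1)) E = E by omega]
  refine ⟨by omega, by omega, rfl, ?_, ?_, ?_⟩
  · funext s
    by_cases hs : s = i
    · simp [hs]
    · simp [hs, h2 s hs]
  · funext s
    by_cases hs : s = i + 1
    · subst hs; simp; omega
    · by_cases hs' : s = i
      · subst hs'; simp; omega
      · simp [hs, h2 s hs', m3 s hs' hs]
  · funext ⟨u, v⟩
    by_cases hu : u = i
    · subst hu
      rw [if_neg (by simp)]
      by_cases hv : nu u ≤ v ∧ v ≤ nu u + p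
      · obtain ⟨j, rfl⟩ := Nat.exists_eq_add_of_le hv.1
        have q1 : u + (nu u + j) - (u + nu u) = j := by omega
        simp only [q1]
        rw [if_pos ⟨by omega, P1 j (by omega)⟩, tab_at _ _ _ _ _ j rfl (by omega)]
        by_cases hv' : j < p
        · rw [P1 _ (by omega), tab_at _ _ _ _ _ j (by omega) (by omega),
            mv_a _ _ _ _ _ hv']
        · have : j = p := by omega
          subst this
          rw [show j + 1 = j + 1 + 0 from rfl, P2, min_eq_left (by omega),
            tab_at _ _ _ _ _ q (by omega) (by omega), mv_d]
      · rw [if_neg]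
        · by_cases hv3 : nu u ≤ v ∧ v < nu u + mu u
          · rw [tab_at _ _ _ _ _ (v - nu u) (by omega) (by omega),
              tab_at _ _ _ _ _ (v - nu u - 1) (by omega) (by omega),
              mv_b _ _ _ _ _ (by omega), show v - nu u - 1 + 1 = v - nu u by omega]
          · rw [tab_out _ _ _ _ _ (by omega), tab_out _ _ _ _ _ (by omega)]
        · rintro ⟨h3, h4⟩
          simp only at h3 h4
          rw [show u + v - (u + nu u) = p + 1 + (v - nu u - p - 1) by omega, P2] at h4
          simp at h4
    by_cases hu' : u = i + 1
    · subst hu'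
      by_cases hvE : v = E
      · rw [if_pos (by rw [hvE]), tab_out _ _ _ _ _ (by omega)]
      rw [if_neg (by simp [hvE])]
      by_cases hv : nu i + p ≤ v ∧ v < E
      · obtain ⟨j, rfl⟩ := Nat.exists_eq_add_of_le hv.1
        have q1 : i + 1 + (nu i + p + j) - (i + nu i) = p + 1 + j := by omega
        simp only [q1]
        rw [if_pos ⟨by omega, by rw [P2, min_eq_left (by omega)]⟩, Nat.add_assoc (p + 1) j 1, P2,
          min_eq_left (by omega), tab_at _ _ _ _ _ (q + j) (by omega) (by omega),
          tab_at _ _ _ _ _ (q + j + 1) (by omega) (by omega), mv_e _ _ _ _ _ (by omega)]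
      · rw [if_neg]
        · by_cases hv3 : nu (i + 1) ≤ v ∧ v < nu (i + 1) + mu (i + 1)
          · rw [tab_at _ _ _ _ _ (v - nu (i + 1)) (by omega) (by omega),
              tab_at _ _ _ _ _ (v - nu (i + 1)) (by omega) (by omega),
              mv_c _ _ _ _ _ (by omega)]
          · rw [tab_out _ _ _ _ _ (by omega), tab_out _ _ _ _ _ (by omega)]
        · rintro ⟨h3, h4⟩
          simp only at h3 h4
          by_cases h5 : i + 1 + v - (i + nu i) ≤ p
          · rw [P1 _ h5] at h4
            simp at h4
          · rw [show i + 1 + v - (i + nu i) = p + 1 + (i + 1 + v - (i + nu i) - p - 1) by omega,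
              P2] at h4
            simp only [Prod.mk.injEq] at h4
            omega
    · rw [if_neg (by simp [hu']), if_neg]
      · simp only [tab, h2 u hu, m3 u hu hu', mv_f x i p q u _ hu hu']
      · rintro ⟨h3, h4⟩
        simp only at h3 h4
        by_cases h5 : u + v - (i + nu i) ≤ p
        · rw [P1 _ h5] at h4
          simp only [Prod.mk.injEq] at h4
          omega
        · rw [show u + v - (i + nu i) = p + 1 + (u + v - (i + nu i) - p - 1) by omega,
            P2] at h4
          simp only [Prod.mk.injEq] at h4
          omega

theorem mv_rows (n : ℕ) (mu mu' : ℕ → ℕ) (x : ℕ → ℕ → ℕ) (i p q : ℕ)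
    (hx : RowsOK n mu x)
    (m1 : mu' i + 1 = mu i) (m2 : mu' (i + 1) = mu (i + 1) + 1)
    (m3 : ∀ s, s ≠ i → s ≠ i + 1 → mu' s = mu s)
    (hpa : p < mu i) (hqb : q ≤ mu (i + 1))
    (c1 : 0 < q → x (i + 1) (q - 1) < x i p)
    (c2 : q < mu (i + 1) → x i p < x (i + 1) q) :
    RowsOK n mu' (mv x i p q) := by
  -- index map
  have key : ∃ f : ℕ → ℕ → ℕ × ℕ, (∀ r j, mv x i p q r j = x (f r j).1 (f r j).2) ∧
      (∀ r j, j < mu' r → (f r j).2 < mu (f r j).1) ∧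
      (∀ r j r' j', j < mu' r → j' < mu' r' → f r j = f r' j' → r = r' ∧ j = j') ∧
      (∀ r j, j < mu r → ∃ r' j', j' < mu' r' ∧ f r' j' = (r, j)) := by
    refine ⟨fun r j => if r = i then (if j < p then (i, j) else (i, j + 1))
      else if r = i + 1 then
        (if j < q then (i + 1, j) else if j = q then (i, p) else (i + 1, j - 1))
      else (r, j), ?_, ?_, ?_, ?_⟩
    · intro r j
      simp only [mv]
      split_ifs <;> rfl
    · intro r j hj
      have := m3 r
      by_cases h : r = i
      · subst h; simp only [if_true]; split_ifs <;> simp only <;> omega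
      by_cases h' : r = i + 1
      · subst h'; simp only [h, if_true, if_false]; split_ifs <;> simp only <;> omega
      · simp only [h, h', if_false]; have := this h h'; omega
    · intro r j r' j' hj hj' he
      have a1 := m3 r
      have a2 := m3 r'
      dsimp only at he
      split_ifs at he <;> simp only [Prod.mk.injEq] at he <;> omega
    · intro r j hj
      by_cases h : r = i
      · subst h
        rcases lt_trichotomy j p with h1 | h1 | h1
        · exact ⟨r, j, by omega, by simp [h1]⟩
        · exact ⟨r + 1, q, by omega, by simp [h1]⟩
        · refine ⟨r, j - 1, by omega, ?_⟩
          dsimp only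
          rw [if_pos rfl, if_neg (by omega)]; congr 1; omega
      by_cases h' : r = i + 1
      · subst h'
        by_cases h1 : j < q
        · exact ⟨i + 1, j, by omega, by simp [h1]⟩
        · refine ⟨i + 1, j + 1, by omega, ?_⟩
          dsimp only
          rw [if_neg (by omega), if_pos rfl, if_neg (by omega), if_neg (by omega)]; rfl
      · exact ⟨r, j, by rw [m3 r h h']; exact hj, by simp [h, h']⟩
  obtain ⟨f, f1, f2, f3, f4⟩ := key
  refine ⟨?_, ?_, ?_, ?_⟩
  · intro r j hj
    rw [f1]; exact hx.bd _ _ (f2 r j hj)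
  · intro r j r' j' hj hj' he
    rw [f1, f1] at he
    obtain ⟨g1, g2⟩ := hx.inj _ _ _ _ (f2 r j hj) (f2 r' j' hj') he
    exact f3 _ _ _ _ hj hj' (Prod.ext g1 g2)
  · intro m h1 h2
    obtain ⟨r, j, hj, he⟩ := hx.surj m h1 h2
    obtain ⟨r', j', hj', he'⟩ := f4 r j hj
    refine ⟨r', j', hj', ?_⟩
    rw [f1, he']; exact he
  · intro r j hj
    simp only [mv]
    by_cases h : r = i
    · subst h
      simp only [if_true]
      have r1 := hx.row r j
      have r2 := hx.row r (j + 1)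
      split_ifs
      · exact r1 (by omega)
      · have := r1 (by omega); have := r2 (by omega); omega
      · omega
      · exact r2 (by omega)
    by_cases h' : r = i + 1
    · subst h'
      simp only [h, if_true, if_false]
      rcases lt_trichotomy (j + 1) q with h1 | h1 | h1
      · rw [if_pos (by omega), if_pos h1]; exact hx.row _ _ (by omega)
      · rw [if_pos (by omega), if_neg (by omega), if_pos h1]
        have := c1 (by omega)
        rwa [show q - 1 = j by omega] at this
      · by_cases h2 : j = q
        · rw [if_neg (by omega), if_pos h2, if_neg (by omega), if_neg (by omega), h2]
          exact c2 (by omega)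
        · rw [if_neg (by omega), if_neg h2, if_neg (by omega), if_neg (by omega)]
          have := hx.row (i + 1) (j - 1) (by omega)
          rwa [show j - 1 + 1 = j + 1 - 1 by omega] at this
    · simp only [h, h', if_false]
      exact hx.row _ _ (by rw [← m3 r h h']; exact hj)

abbrev Stt := (ℕ → ℕ) × (ℕ → ℕ) × (ℕ × ℕ → ℕ)

theorem row_mono {n : ℕ} {mu : ℕ → ℕ} {x : ℕ → ℕ → ℕ} (hx : RowsOK n mu x) (r j t : ℕ)
    (h : j + t < mu r) : x r j ≤ x r (j + t) := by
  induction t with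
  | zero => simp
  | succ t ih =>
    have := ih (by omega)
    have := hx.row r (j + t) (by omega)
    rw [show j + (t + 1) = j + t + 1 by omega]
    omega

/-- Shifting row `r` to the right by `t` when it is free to move. -/
theorem shiftRow {n : ℕ} {mu : ℕ → ℕ} {x : ℕ → ℕ → ℕ} {Z : Stt} (hx : RowsOK n mu x)
    (nu : ℕ → ℕ) (r t : ℕ) (hg : ∀ s, Pair mu x nu s)
    (hfree : ∀ s, r = s + 1 → nu r + t + mu r ≤ nu s)
    (hZ : Relation.ReflTransGen JdtSlide (stt mu x nu) Z) :
    ∃ nu' : ℕ → ℕ, nu' r = nu r + t ∧ (∀ s, s ≠ r → nu' s = nu s) ∧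
      (∀ s, Pair mu x nu' s) ∧ Relation.ReflTransGen JdtSlide (stt mu x nu') Z := by
  induction t with
  | zero => exact ⟨nu, rfl, fun _ _ => rfl, hg, hZ⟩
  | succ t ih =>
    obtain ⟨nu1, a1, a2, a3, a4⟩ := ih (fun s hs => by have := hfree s hs; omega)
    have b1 : Function.update nu1 r (nu1 r + 1) r = nu1 r + 1 := by simp
    have b2 : ∀ s, s ≠ r → Function.update nu1 r (nu1 r + 1) s = nu1 s := by
      intro s hs; simp [hs]
    refine ⟨Function.update nu1 r (nu1 r + 1), by rw [b1]; omega,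
      fun s hs => by rw [b2 s hs, a2 s hs], ?_,
      Relation.ReflTransGen.head (slideA mu x nu1 _ r (a3 r) b1 b2) a4⟩
    intro s
    by_cases h1 : s = r
    · subst h1
      obtain ⟨c1, c2, c3⟩ := a3 s
      have d := b2 (s + 1) (by omega)
      refine ⟨by omega, by omega, ?_⟩
      intro j k hjk hk
      have e1 := c3 (j + 1) k (by omega) hk
      have e2 := row_mono hx s j 1 (by omega)
      omega
    by_cases h2 : s + 1 = r
    · apply DiscAt.pair
      unfold DiscAt
      have d := b2 s h1
      have d1 := a2 s h1
      have := hfree s h2.symm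
      rw [h2]
      omega
    · obtain ⟨c1, c2, c3⟩ := a3 s
      unfold Pair
      rw [b2 _ h1, b2 _ h2]
      exact ⟨c1, c2, c3⟩

theorem spread {n : ℕ} {mu : ℕ → ℕ} {x : ℕ → ℕ → ℕ} {Z : Stt} (hx : RowsOK n mu x)
    (nu : ℕ → ℕ) (hg : ∀ s, Pair mu x nu s)
    (hZ : Relation.ReflTransGen JdtSlide (stt mu x nu) Z) (s K : ℕ) :
    ∃ nu' : ℕ → ℕ, nu' s = nu s + K ∧ (∀ r, s < r → nu' r = nu r) ∧
      (∀ r, r < s → DiscAt mu nu' r) ∧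
      (∀ r, Pair mu x nu' r) ∧ Relation.ReflTransGen JdtSlide (stt mu x nu') Z := by
  induction s generalizing K with
  | zero =>
    obtain ⟨nu1, a1, a2, a3, a4⟩ := shiftRow hx nu 0 K hg (fun s hs => by omega) hZ
    exact ⟨nu1, a1, fun r hr => a2 r (by omega), fun r hr => by omega, a3, a4⟩
  | succ s ih =>
    obtain ⟨nu1, a1, a2, a3, a4, a5⟩ := ih (nu (s + 1) + K + mu (s + 1))
    have e := a2 (s + 1) (by omega)
    obtain ⟨nu2, b1, b2, b3, b4⟩ := shiftRow hx nu1 (s + 1) K a4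
      (fun s' hs => by
        have : s' = s := by omega
        subst this
        omega) a5
    refine ⟨nu2, by omega, fun r hr => by rw [b2 r (by omega), a2 r (by omega)], ?_, b3, b4⟩
    intro r hr
    by_cases h : r = s
    · subst h
      unfold DiscAt
      have := b2 r (by omega)
      omega
    · have := a3 r (by omega)
      unfold DiscAt at this ⊢
      rw [b2 r (by omega), b2 (r + 1) (by omega)]
      exact this

def Good (n l : ℕ) (Z : Stt) (mu : ℕ → ℕ) : Prop :=
  ∃ (x : ℕ → ℕ → ℕ) (nu : ℕ → ℕ), RowsOK n mu x ∧ (∀ r, DiscAt mu nu r) ∧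
    (∀ r, l ≤ r → nu r = 0 ∧ mu r = 0) ∧ Relation.ReflTransGen JdtSlide (stt mu x nu) Z

theorem good_of_geo {n l : ℕ} {mu : ℕ → ℕ} {x : ℕ → ℕ → ℕ} {Z : Stt} (hx : RowsOK n mu x)
    (nu : ℕ → ℕ) (hg : ∀ s, Pair mu x nu s) (ht : ∀ r, l ≤ r → nu r = 0 ∧ mu r = 0)
    (hZ : Relation.ReflTransGen JdtSlide (stt mu x nu) Z) : Good n l Z mu := by
  obtain ⟨nu1, a1, a2, a3, a4, a5⟩ := spread hx nu hg hZ l 0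
  have e : ∀ r, l ≤ r → nu1 r = nu r := by
    intro r hr
    rcases Nat.eq_or_lt_of_le hr with h | h
    · subst h; omega
    · exact a2 r h
  refine ⟨x, nu1, hx, ?_, fun r hr => ⟨by rw [e r hr]; exact (ht r hr).1, (ht r hr).2⟩, a5⟩
  intro r
  by_cases h : r < l
  · exact a3 r h
  · unfold DiscAt
    have := e (r + 1) (by omega)
    have := ht (r + 1) (by omega)
    omega

theorem step_cross {n l : ℕ} {Z : Stt} {mu mu' : ℕ → ℕ} {x : ℕ → ℕ → ℕ} (i : ℕ)
    (hx : RowsOK n mu x) (hi : i + 1 < l) (hlt : mu (i + 1) < mu i)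
    (m1 : mu' i + 1 = mu i) (m2 : mu' (i + 1) = mu (i + 1) + 1)
    (m3 : ∀ s, s ≠ i → s ≠ i + 1 → mu' s = mu s) (d : ℕ) (nu : ℕ → ℕ)
    (hd : nu i = nu (i + 1) + d) (hp : Pair mu x nu i) (hD : ∀ s, s ≠ i → DiscAt mu nu s)
    (ht : ∀ r, l ≤ r → nu r = 0 ∧ mu r = 0)
    (hZ : Relation.ReflTransGen JdtSlide (stt mu x nu) Z)
    (p : ℕ) (p1 : p + d ≤ mu (i + 1)) (p2 : 0 < p + d → x (i + 1) (p + d - 1) < x i p)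
    (p3 : ∀ p', p < p' → p' + d ≤ mu (i + 1) → x i p' < x (i + 1) (p' + d - 1)) :
    Good n l Z mu' := by
  obtain ⟨hp1, hp2, hc⟩ := id hp
  have hx' : RowsOK n mu' (mv x i p (p + d)) :=
    mv_rows n mu mu' x i p (p + d) hx m1 m2 m3 (by omega) p1 p2
      (fun h => hc _ _ (by omega) h)
  have b1 : Function.update nu i (nu i + 1) i = nu i + 1 := by simp
  have b2 : ∀ s, s ≠ i → Function.update nu i (nu i + 1) s = nu s := by
    intro s hs; simp [hs]
  refine good_of_geo hx' (Function.update nu i (nu i + 1)) ?_ ?_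
    (Relation.ReflTransGen.head (slideB mu mu' x nu _ i p (p + d) hp (hD (i + 1) (by omega))
      (hx.row i) b1 b2 m1 m2 m3 (by omega) (by omega) p1) hZ)
  · intro s
    by_cases h1 : s = i
    · subst h1
      have e := b2 (s + 1) (by omega)
      refine ⟨by omega, by omega, ?_⟩
      intro j k hjk hk
      rcases lt_trichotomy k (p + d) with h | h | h
      · rw [mv_a _ _ _ _ _ (by omega), mv_c _ _ _ _ _ h]
        have := hx.row s j (by omega)
        have := hc (j + 1) k (by omega) (by omega)
        omega
      · rw [mv_a _ _ _ _ _ (by omega), h, mv_d]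
        have := hx.row s j (by omega)
        rwa [show j + 1 = p by omega] at this
      · obtain ⟨k', rfl⟩ : ∃ k', k = k' + 1 := ⟨k - 1, by omega⟩
        rw [mv_b _ _ _ _ _ (by omega), mv_e _ _ _ _ _ (by omega)]
        have := p3 (j + 1) (by omega) (by omega)
        rwa [show j + 1 + d - 1 = k' by omega] at this
    · apply DiscAt.pair
      have h := hD s h1
      unfold DiscAt at h ⊢
      rw [b2 s h1]
      by_cases h2 : s + 1 = i
      · rw [h2] at h ⊢; omega
      · rw [b2 _ h2]
        have := m3 (s + 1) h2 (by omega)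
        omega
  · intro r hr
    rw [b2 r (by omega), m3 r (by omega) (by omega)]
    exact ht r hr

theorem step_aux {n l : ℕ} {Z : Stt} {mu mu' : ℕ → ℕ} {x : ℕ → ℕ → ℕ} (i : ℕ)
    (hx : RowsOK n mu x) (hi : i + 1 < l) (hlt : mu (i + 1) < mu i)
    (m1 : mu' i + 1 = mu i) (m2 : mu' (i + 1) = mu (i + 1) + 1)
    (m3 : ∀ s, s ≠ i → s ≠ i + 1 → mu' s = mu s) (d : ℕ) :
    ∀ nu : ℕ → ℕ, nu i = nu (i + 1) + d → Pair mu x nu i → (∀ s, s ≠ i → DiscAt mu nu s) →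
      (∀ r, l ≤ r → nu r = 0 ∧ mu r = 0) →
      Relation.ReflTransGen JdtSlide (stt mu x nu) Z → Good n l Z mu' := by
  induction d with
  | zero =>
    intro nu hd hp hD ht hZ
    let Q : ℕ → Prop := fun p => 0 < p → x (i + 1) (p - 1) < x i p
    have q0 : Q 0 := fun h => absurd h (by omega)
    have q1 : Q (Nat.findGreatest Q (mu (i + 1))) :=
      Nat.findGreatest_spec (Nat.zero_le _) q0
    have q2 := Nat.findGreatest_le (P := Q) (mu (i + 1))
    refine step_cross i hx hi hlt m1 m2 m3 0 nu hd hp hD ht hZ _ q2 q1 ?_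
    intro p' h1 h2
    have h3 : ¬ Q p' := Nat.findGreatest_is_greatest h1 h2
    simp only [Q, not_forall] at h3
    obtain ⟨h4, h5⟩ := h3
    rcases Nat.lt_or_eq_of_le (Nat.not_lt.mp h5) with h | h
    · exact h
    · have := (hx.inj i p' (i + 1) (p' - 1) (by omega) (by omega) h).1
      omega
  | succ d ih =>
    intro nu hd hp hD ht hZ
    by_cases hex : ∃ p, p + (d + 1) ≤ mu (i + 1) ∧ x (i + 1) (p + d) < x i p
    · let Q : ℕ → Prop := fun p => p + (d + 1) ≤ mu (i + 1) ∧ x (i + 1) (p + d) < x i p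
      obtain ⟨p, hp'⟩ := hex
      have q1 : Q (Nat.findGreatest Q (mu (i + 1))) :=
        Nat.findGreatest_spec (m := p) (by omega) hp'
      refine step_cross i hx hi hlt m1 m2 m3 (d + 1) nu hd hp hD ht hZ _ q1.1
        (fun _ => q1.2) ?_
      intro p' h1 h2
      have h3 : ¬ Q p' := Nat.findGreatest_is_greatest h1 (by omega)
      have h5 : ¬ x (i + 1) (p' + d) < x i p' := fun h => h3 ⟨h2, h⟩
      rcases Nat.lt_or_eq_of_le (Nat.not_lt.mp h5) with h | h
      · exact h
      · have := (hx.inj i p' (i + 1) (p' + d) (by omega) (by omega) h).1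
        omega
    · obtain ⟨hp1, hp2, hc⟩ := hp
      have b1 : Function.update nu (i + 1) (nu (i + 1) + 1) (i + 1) = nu (i + 1) + 1 := by simp
      have b2 : ∀ s, s ≠ i + 1 → Function.update nu (i + 1) (nu (i + 1) + 1) s = nu s := by
        intro s hs; simp [hs]
      have b3 := b2 i (by omega)
      refine ih (Function.update nu (i + 1) (nu (i + 1) + 1)) (by omega) ?_ ?_ ?_
        (Relation.ReflTransGen.head
          (slideA mu x nu _ (i + 1) ((hD (i + 1) (by omega)).pair x) b1 b2) hZ)
      · refine ⟨by omega, by omega, ?_⟩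
        intro j k hjk hk
        have h5 : ¬ x (i + 1) (j + d) < x i j := fun h => hex ⟨j, by omega, h⟩
        have e : k = j + d := by omega
        subst e
        rcases Nat.lt_or_eq_of_le (Nat.not_lt.mp h5) with h | h
        · exact h
        · have := (hx.inj i j (i + 1) (j + d) (by omega) (by omega) h).1
          omega
      · intro s hs
        have h := hD s hs
        unfold DiscAt at h ⊢
        by_cases h2 : s = i + 1
        · subst h2
          have := b2 (i + 1 + 1) (by omega)
          omega
        · rw [b2 _ h2, b2 _ (by omega)]
          exact h
      · intro r hr
        rw [b2 r (by omega)]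
        exact ht r hr

theorem good_step {n l : ℕ} {Z : Stt} {mu mu' : ℕ → ℕ} (i : ℕ) (hG : Good n l Z mu)
    (hi : i + 1 < l) (hlt : mu (i + 1) < mu i)
    (m1 : mu' i + 1 = mu i) (m2 : mu' (i + 1) = mu (i + 1) + 1)
    (m3 : ∀ s, s ≠ i → s ≠ i + 1 → mu' s = mu s) : Good n l Z mu' := by
  obtain ⟨x, nu, hx, hD, ht, hZ⟩ := hG
  have h := hD i
  unfold DiscAt at h
  exact step_aux i hx hi hlt m1 m2 m3 (nu i - nu (i + 1)) nu (by omega) ((hD i).pair x)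
    (fun s _ => hD s) ht hZ

theorem good_grow {n l : ℕ} {Z : Stt} {mu : ℕ → ℕ} (k : ℕ) (hG : Good n l Z mu)
    (hkl : k < l) (hln : l ≤ n) (ha : ∀ r, mu (r + 1) ≤ mu r) (hk : ∀ r, 0 < mu r ↔ r < k) :
    ∃ mu', Good n l Z mu' ∧ (∀ r, mu' (r + 1) ≤ mu' r) ∧ (∀ r, 0 < mu' r ↔ r < k + 1) := by
  have hex : ∃ p, 2 ≤ mu p := by
    by_contra hcon
    push Not at hcon
    obtain ⟨x, nu, hx, -⟩ := hG
    have hsub : Finset.Icc 1 n ⊆ (Finset.range k).image (fun r => x r 0) := by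
      intro m hm
      rw [Finset.mem_Icc] at hm
      obtain ⟨r, j, hj, he⟩ := hx.surj m hm.1 hm.2
      have := hcon r
      have hj0 : j = 0 := by omega
      subst hj0
      exact Finset.mem_image.mpr ⟨r, Finset.mem_range.mpr ((hk r).mp hj), he⟩
    have h1 := Finset.card_le_card hsub
    have h2 := Finset.card_image_le (s := Finset.range k) (f := fun r => x r 0)
    simp at h1 h2
    omega
  obtain ⟨p0, hp0⟩ := hex
  let Q : ℕ → Prop := fun p => 2 ≤ mu p
  have hlt0 : ∀ r, 2 ≤ mu r → r < k := fun r hr => (hk r).mp (by omega)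
  obtain ⟨p, hpd⟩ : ∃ p, p = Nat.findGreatest Q k := ⟨_, rfl⟩
  have q1 : 2 ≤ mu p := by
    rw [hpd]
    exact Nat.findGreatest_spec (P := Q) (hlt0 p0 hp0).le hp0
  have q2 : ∀ r, p < r → mu r ≤ 1 := by
    intro r hr
    by_contra hcon
    have h2 : 2 ≤ mu r := by omega
    exact Nat.findGreatest_is_greatest (P := Q) (n := k) (by omega) (hlt0 r h2).le h2
  have hpk := hlt0 p q1
  have chain : ∀ s, p + s + 1 ≤ k → Good n l Z
      (fun r => if r = p then mu p - 1 else if r = p + s + 1 then mu r + 1 else mu r) := by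
    intro s
    induction s with
    | zero =>
      intro hs
      refine good_step p hG (by omega) ?_ ?_ ?_ ?_
      · have := q2 (p + 1) (by omega); omega
      · simp; omega
      · simp
      · intro s h1 h2; simp [h1, h2]
    | succ s ih =>
      intro hs
      have h1 := q2 (p + s + 1 + 1) (by omega)
      have h2 := (hk (p + s + 1)).mpr (by omega)
      refine good_step (p + s + 1) (ih (by omega)) (by omega) ?_ ?_ ?_ ?_
      · rw [if_neg (by omega), if_neg (by omega), if_neg (by omega), if_pos rfl]; omega
      · rw [if_neg (by omega), if_neg (by omega), if_neg (by omega), if_pos rfl]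
      · rw [if_neg (by omega), if_pos (by omega), if_neg (by omega), if_neg (by omega)]
      · intro r h3 h4
        by_cases h5 : r = p
        · simp [h5]
        · rw [if_neg h5, if_neg (by omega), if_neg h5, if_neg h3]
  have hfin := chain (k - p - 1) (by omega)
  rw [show p + (k - p - 1) + 1 = k by omega] at hfin
  refine ⟨_, hfin, ?_, ?_⟩
  · intro r
    have e1 := ha r
    have e2 := q2 (r + 1)
    have e3 := hk r
    have e4 := hk (r + 1)
    have e5 := q2 r
    by_cases c1 : r = p
    · subst c1
      have := e2 (by omega)
      simp only
      split_ifs <;> omega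
    · by_cases c2 : r + 1 = p
      · subst c2
        simp only
        split_ifs <;> omega
      · split_ifs <;> omega
  · intro r
    have e3 := hk r
    split_ifs with h1 h2
    · subst h1; omega
    · omega
    · omega

theorem good_final {n l : ℕ} {Z : Stt} (hln : l ≤ n) (e : ℕ) :
    ∀ (k : ℕ) (mu : ℕ → ℕ), k + e = l → Good n l Z mu → (∀ r, mu (r + 1) ≤ mu r) →
      (∀ r, 0 < mu r ↔ r < k) →
      ∃ mu', Good n l Z mu' ∧ (∀ r, mu' (r + 1) ≤ mu' r) ∧ (∀ r, 0 < mu' r ↔ r < l) := by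
  induction e with
  | zero =>
    intro k mu h hG ha hk
    have : k = l := by omega
    subst this
    exact ⟨mu, hG, ha, hk⟩
  | succ e ih =>
    intro k mu h hG ha hk
    obtain ⟨mu', a, b, c⟩ := good_grow k hG (by omega) hln ha hk
    exact ih (k + 1) mu' (by omega) a b c

/-- Let `R` be a standard Young tableau of shape `lam ⊢ n` with at most `l` rows,
where `l ≤ n`.  Then there are a weakly decreasing skew shape `σ = λ̂/ν` with
`ℓ(σ) = l` (and `|σ| = n`) and a standard skew Young tableau `S` of shape `σ`
whose rectification is `R`: some finite sequence of jeu de taquin slides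
transforms the state `(ν, λ̂, S)` into the state `(∅, lam, R)`. -/
theorem stmt_11 (n l : ℕ) (hn : 1 ≤ n) (hl1 : 1 ≤ l) (hln : l ≤ n)
    (lam : ℕ → ℕ) (hpart : IsPartition lam n) (hrows : ∀ i : ℕ, l ≤ i → lam i = 0)
    (R : ℕ × ℕ → ℕ) (hR : IsFinSYT lam n R) :
    ∃ (nu lamh : ℕ → ℕ) (S : ℕ × ℕ → ℕ),
      IsSkewShape nu lamh n ∧ WeaklyDecreasing nu lamh ∧ SkewHeight nu lamh l ∧
      IsSkewSYT nu lamh n S ∧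
      Relation.ReflTransGen JdtSlide (nu, lamh, S) ((fun _ => 0), lam, R) := by
  have hx : RowsOK n lam (fun r j => R (r, j)) := by
    refine ⟨fun r j hj => ⟨hR.lb (r, j) hj, hR.ub (r, j) hj⟩, ?_, ?_, ?_⟩
    · intro r j r' j' h1 h2 he
      have := hR.inj (r, j) (r', j') h1 h2 he
      simpa using this
    · intro m h1 h2
      obtain ⟨⟨r, j⟩, hb, he⟩ := hR.surj m h1 h2
      exact ⟨r, j, hb, he⟩
    · intro r j hj
      exact hR.row_lt (r, j) hj
  have hst : stt lam (fun r j => R (r, j)) (fun _ => 0) = ((fun _ => 0), lam, R) := by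
    simp only [stt, Nat.zero_add, Prod.mk.injEq, true_and]
    funext ⟨u, v⟩
    simp only [tab, Nat.zero_le, Nat.zero_add, true_and, Nat.sub_zero]
    split_ifs with h
    · rfl
    · exact (hR.zero_outside (u, v) h).symm
  have hG : Good n l ((fun _ => 0), lam, R) lam := by
    refine good_of_geo hx (fun _ => 0) ?_ (fun r hr => ⟨rfl, hrows r hr⟩) ?_
    · intro s
      refine ⟨le_rfl, by simpa using hpart.antitone s, ?_⟩
      intro j k hjk hk
      simp only [Nat.zero_add] at hjk
      subst hjk
      exact hR.col_lt (s, j) hk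
    · rw [hst]
  have hanti : Antitone lam := antitone_nat_of_succ_le hpart.antitone
  have hz : ∃ k, lam k = 0 := ⟨l, hrows l le_rfl⟩
  have hkl : Nat.find hz ≤ l := Nat.find_min' hz (hrows l le_rfl)
  have hk : ∀ r, 0 < lam r ↔ r < Nat.find hz := by
    intro r
    constructor
    · intro h
      by_contra hcon
      have h1 := hanti (Nat.not_lt.mp hcon)
      rw [Nat.find_spec hz] at h1
      omega
    · intro h
      exact Nat.pos_of_ne_zero (Nat.find_min hz h)
  obtain ⟨mu, ⟨x, nu, hx', hD, ht, hZ⟩, ha, hpos⟩ :=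
    good_final hln (l - Nat.find hz) (Nat.find hz) lam (by omega) hG hpart.antitone hk
  have hS : IsSkewSYT nu (fun r => nu r + mu r) n (tab mu x nu) := by
    have hin : ∀ r c, SkewBox nu (fun r => nu r + mu r) (r, c) →
        ∃ j, c = nu r + j ∧ j < mu r ∧ tab mu x nu (r, c) = x r j := by
      rintro r c ⟨h1, h2⟩
      simp only at h1 h2
      exact ⟨c - nu r, by omega, by omega, tab_at _ _ _ _ _ _ (by omega) (by omega)⟩
    refine ⟨?_, ?_, ?_, ?_, ?_, ?_, ?_⟩
    · rintro ⟨r, c⟩ h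
      simp only [SkewBox] at h
      exact tab_out _ _ _ _ _ (by omega)
    · rintro ⟨r, c⟩ h
      obtain ⟨j, -, hj, he⟩ := hin r c h
      rw [he]; exact (hx'.bd r j hj).1
    · rintro ⟨r, c⟩ h
      obtain ⟨j, -, hj, he⟩ := hin r c h
      rw [he]; exact (hx'.bd r j hj).2
    · rintro ⟨r, c⟩ ⟨r', c'⟩ h h' heq
      obtain ⟨j, h1, hj, he⟩ := hin r c h
      obtain ⟨j', h1', hj', he'⟩ := hin r' c' h'
      rw [he, he'] at heq
      obtain ⟨g1, g2⟩ := hx'.inj _ _ _ _ hj hj' heq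
      subst g1 g2
      rw [h1, h1']
    · intro m h1 h2
      obtain ⟨r, j, hj, he⟩ := hx'.surj m h1 h2
      refine ⟨(r, nu r + j), ⟨by simp, by simp [hj]⟩, ?_⟩
      rw [tab_at _ _ _ _ _ j rfl hj, he]
    · rintro ⟨r, c⟩ h h'
      obtain ⟨j, h1, hj, he⟩ := hin r c h
      obtain ⟨j', h1', hj', he'⟩ := hin r (c + 1) h'
      have : j' = j + 1 := by omega
      subst this
      simp only
      rw [he, he']
      exact hx'.row r j hj'
    · rintro ⟨r, c⟩ h h'
      obtain ⟨h1, h2⟩ := h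
      obtain ⟨h3, h4⟩ := h'
      have := hD r
      unfold DiscAt at this
      simp only at h1 h2 h3 h4
      omega
  have himg : Set.BijOn (tab mu x nu) {b | SkewBox nu (fun r => nu r + mu r) b}
      (Set.Icc 1 n) := by
    refine ⟨fun b hb => ⟨hS.lb b hb, hS.ub b hb⟩, fun b hb c hc h => hS.inj b c hb hc h, ?_⟩
    rintro m ⟨h1, h2⟩
    obtain ⟨b, hb, he⟩ := hS.surj m h1 h2
    exact ⟨b, hb, he⟩
  refine ⟨nu, fun r => nu r + mu r, tab mu x nu, ⟨?_, ?_, ?_, ?_, ?_⟩, ?_, ⟨?_, ?_⟩, hS, hZ⟩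
  · intro r; have := hD r; unfold DiscAt at this; omega
  · intro r; have := hD r; unfold DiscAt at this; omega
  · intro r; simp
  · exact Set.Finite.of_finite_image (by rw [himg.image_eq]; exact Set.finite_Icc 1 n) himg.injOn
  · rw [← Set.ncard_image_of_injOn himg.injOn, himg.image_eq, ← Finset.coe_Icc,
      Set.ncard_coe_finset, Nat.card_Icc]
    omega
  · intro r; simpa using ha r
  · have := (hpos (l - 1)).mpr (by omega)
    simp only; omega
  · intro r hr; have := (ht r hr).2; simp only; omega
end

section
/- Let l, k ∈ ℕ and T ∈ SYT((∞^l)). Then T is k-pre-periodic (i.e., there exists N ∈ ℕ with jdt^{N+k}(T) = jdt^N(T)) if and only if there exist a weakly decreasing skew shape σ contained in (∞^l) with ℓ(σ) = l and |σ| = k, a standard skew Young tableau S of shape σ, n ∈ ℕ, a partition λ of n with at most l rows, and a standard Young tableau B of shape λ such that B ◁ S is a standard filling and T = B ◁ S ◁ S ◁ ⋯ (the iterated left smash of B with infinitely many copies of S). -/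
open scoped Classical

/-- Iterated left smash `B ◁ S ◁ S ◁ ⋯` of a finite standard Young tableau `B` of
shape `lam` (a partition of `n`) with infinitely many copies of a standard skew
Young tableau `S` of shape `λ̂ / ν` with `k` boxes: row `i` of the result starts
with row `i` of `B` and then consists of the successive copies of row `i` of `S`
(of length `lamh i - nu i`), the `c`-th copy being incremented by `n + c * k`. -/
noncomputable def smashInf (l : ℕ∞) (n k : ℕ) (lam : ℕ → ℕ) (B : ℕ × ℕ → ℕ)
    (nu lamh : ℕ → ℕ) (S : ℕ × ℕ → ℕ) : ℕ × ℕ → ℕ := fun b =>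
  if Box l b then
    if b.2 < lam b.1 then B b
    else S (b.1, nu b.1 + (b.2 - lam b.1) % (lamh b.1 - nu b.1)) + n
          + ((b.2 - lam b.1) / (lamh b.1 - nu b.1)) * k
  else 0

/-- `B ◁ S` is a standard filling: the finite filling obtained by placing the first
copy of `S` (incremented by `n`) to the right of `B` has strictly increasing rows
and columns. -/
def BSstandard (l n : ℕ) (lam nu lamh : ℕ → ℕ) (B S : ℕ × ℕ → ℕ) : Prop :=
  let F : ℕ × ℕ → ℕ := fun b =>
    if b.2 < lam b.1 then B b else S (b.1, nu b.1 + (b.2 - lam b.1)) + n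
  let m : ℕ → ℕ := fun i => if i < l then lam i + (lamh i - nu i) else 0
  (∀ i j : ℕ, j + 1 < m i → F (i, j) < F (i, j + 1)) ∧
  (∀ i j : ℕ, j < m i → j < m (i + 1) → F (i, j) < F (i + 1, j))

/-- running maximum -/
def rmax (f : ℕ → ℤ) : ℕ → ℤ
  | 0 => f 0
  | m + 1 => max (rmax f m) (f (m + 1))

theorem le_rmax (f : ℕ → ℤ) (m : ℕ) : ∀ s, s ≤ m → f s ≤ rmax f m := by
  induction m with
  | zero => intro s hs; obtain rfl : s = 0 := by omega
            exact le_refl _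
  | succ m ih =>
    intro s hs
    rcases Nat.lt_or_ge m s with h | h
    · obtain rfl : s = m + 1 := by omega
      exact le_max_right _ _
    · exact le_trans (ih s h) (le_max_left _ _)

theorem rmax_att (f : ℕ → ℤ) (m : ℕ) : ∃ s, s ≤ m ∧ f s = rmax f m := by
  induction m with
  | zero => exact ⟨0, le_refl _, rfl⟩
  | succ m ih =>
    obtain ⟨s, hs, h⟩ := ih
    rcases le_total (rmax f m) (f (m + 1)) with h' | h'
    · exact ⟨m + 1, le_refl _, (max_eq_right h').symm⟩
    · exact ⟨s, by omega, by rw [h]; exact (max_eq_left h').symm⟩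

theorem rmax_eq (f : ℕ → ℤ) (m : ℕ) (v : ℤ) (h1 : ∀ s, s ≤ m → f s ≤ v)
    (h2 : ∃ s, s ≤ m ∧ f s = v) : rmax f m = v := by
  obtain ⟨s, hs, h⟩ := h2
  obtain ⟨t, ht, h'⟩ := rmax_att f m
  have := le_rmax f m s hs
  have := h1 t ht
  omega

theorem rmax_mono (f : ℕ → ℤ) {a b : ℕ} (h : a ≤ b) : rmax f a ≤ rmax f b := by
  obtain ⟨t, ht, h'⟩ := rmax_att f a
  rw [← h']
  exact le_rmax f b t (by omega)

/-- Pitman transform on coordinates `i`, `i+1` -/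
def pit (i : ℕ) (x : ℕ → ℕ → ℤ) : ℕ → ℕ → ℤ := fun a m =>
  if a = i then x i m + rmax (fun s => x (i + 1) s - x i s) m
  else if a = i + 1 then x (i + 1) m - rmax (fun s => x (i + 1) s - x i s) m
  else x a m

/-- shift -/
def shf (x : ℕ → ℕ → ℤ) : ℕ → ℕ → ℤ := fun a m => x a (m + 1) - x a 1

/-- lattice path of a word -/
def IsWord (x : ℕ → ℕ → ℤ) : Prop :=
  (∀ i, x i 0 = 0) ∧ ∀ m, ∃ r, ∀ i, x i (m + 1) = x i m + if i = r then 1 else 0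

theorem isWord_shf {x : ℕ → ℕ → ℤ} (h : IsWord x) : IsWord (shf x) := by
  refine ⟨fun i => by simp [shf], fun m => ?_⟩
  obtain ⟨r, hr⟩ := h.2 (m + 1)
  exact ⟨r, fun i => by simp only [shf, hr i]; ring⟩

theorem IsWord.step {x : ℕ → ℕ → ℤ} (h : IsWord x) (i m : ℕ) :
    x (i + 1) (m + 1) - x i (m + 1) ≤ x (i + 1) m - x i m + 1 := by
  obtain ⟨r, hr⟩ := h.2 m
  rw [hr, hr]; split_ifs <;> omega

theorem isWord_pit {x : ℕ → ℕ → ℤ} (i : ℕ) (h : IsWord x) : IsWord (pit i x) := by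
  refine ⟨fun a => ?_, fun m => ?_⟩
  · simp only [pit, rmax, h.1]; split_ifs <;> simp
  · obtain ⟨r, hr⟩ := h.2 m
    have hle := le_rmax (fun s => x (i + 1) s - x i s) m m le_rfl
    by_cases hc : rmax (fun s => x (i + 1) s - x i s) m < x (i + 1) (m + 1) - x i (m + 1)
    · have e : rmax (fun s => x (i + 1) s - x i s) (m + 1)
          = x (i + 1) (m + 1) - x i (m + 1) := max_eq_right hc.le
      have h1 := hr i
      have h2 := hr (i + 1)
      have hri : r = i + 1 := by
        by_contra hne
        rw [if_neg (Ne.symm hne)] at h2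
        split_ifs at h1 <;> omega
      subst hri
      simp at h1 h2
      refine ⟨i, fun a => ?_⟩
      simp only [pit, e]
      by_cases ha : a = i
      · subst ha; simp; omega
      · by_cases ha' : a = i + 1
        · subst ha'; simp; omega
        · simp [ha, ha', hr a]
    · have e : rmax (fun s => x (i + 1) s - x i s) (m + 1)
          = rmax (fun s => x (i + 1) s - x i s) m := max_eq_left (not_lt.mp hc)
      refine ⟨r, fun a => ?_⟩
      simp only [pit, e]
      by_cases ha : a = i
      · subst ha; simp [hr a]; ring
      · by_cases ha' : a = i + 1
        · subst ha'; simp [hr (i+1)]; ring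
        · simp [ha, ha', hr a]

theorem iso_exists (d : ℕ → ℤ) (hd : ∀ m, d (m + 1) ≤ d m + 1) (a : ℕ) (c : ℤ) (ha : d a ≤ c) :
    ∀ u, c ≤ d (a + u) → ∃ t, a ≤ t ∧ t ≤ a + u ∧ d t = c ∧ ∀ s, a ≤ s → s ≤ t → d s ≤ c := by
  intro u
  induction u using Nat.strong_induction_on with
  | _ u ih =>
    intro hu
    by_cases hex : ∃ v, v < u ∧ c ≤ d (a + v)
    · obtain ⟨v, hv, hc⟩ := hex
      obtain ⟨t, h1, h2, h3⟩ := ih v hv hc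
      exact ⟨t, h1, by omega, h3⟩
    · push Not at hex
      have key : d (a + u) = c := by
        rcases u with _ | u
        · simp at hu; simp; omega
        · have := hex u (by omega)
          have := hd (a + u)
          rw [← Nat.add_assoc] at hu ⊢
          omega
      refine ⟨a + u, by omega, le_rfl, key, fun s h1 h2 => ?_⟩
      rcases Nat.lt_or_ge s (a + u) with h | h
      · have := hex (s - a) (by omega)
        rw [Nat.add_sub_cancel' h1] at this
        omega
      · obtain rfl : s = a + u := by omega
        omega

theorem iso_A (d : ℕ → ℤ) (a m : ℕ) (t : ℕ)
    (h1 : a ≤ t) (h2 : t ≤ m) :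
    ∃ t', a ≤ t' ∧ t' ≤ m ∧ rmax d m + rmax d a + d t - 2 * rmax d t ≤ d t' := by
  obtain ⟨s, hs, hs'⟩ := rmax_att d m
  have h3 := rmax_mono d h1
  have h4 := rmax_mono d h2
  have h5 := le_rmax d t t le_rfl
  rcases Nat.lt_or_ge s a with h | h
  · refine ⟨t, h1, h2, ?_⟩
    have := le_rmax d a s h.le
    omega
  · exact ⟨s, h, hs, by omega⟩

theorem iso_B (d : ℕ → ℤ) (hd : ∀ m, d (m + 1) ≤ d m + 1) (a m : ℕ) (t : ℕ)
    (h1 : a ≤ t) (h2 : t ≤ m) :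
    ∃ t', a ≤ t' ∧ t' ≤ m ∧ d t ≤ rmax d m + rmax d a + d t' - 2 * rmax d t' := by
  have h4 := rmax_mono d h2
  have h5 := le_rmax d t t le_rfl
  by_cases hc : rmax d a ≤ d t
  · obtain ⟨t', g1, g2, g3, g4⟩ := iso_exists d hd a (rmax d a) (le_rmax d a a le_rfl) (t - a)
      (by rw [Nat.add_sub_cancel' h1]; exact hc)
    refine ⟨t', g1, by omega, ?_⟩
    have : rmax d t' ≤ rmax d a := by
      obtain ⟨s, hs, hs'⟩ := rmax_att d t'
      rcases Nat.lt_or_ge s a with h | h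
      · have := le_rmax d a s h.le
        omega
      · have := g4 s h hs
        omega
    omega
  · by_cases hex : ∃ s, a ≤ s ∧ s ≤ t ∧ rmax d a ≤ d s
    · obtain ⟨s, e1, e2, e3⟩ := hex
      obtain ⟨t', g1, g2, g3, g4⟩ := iso_exists d hd a (rmax d a) (le_rmax d a a le_rfl) (s - a)
        (by rw [Nat.add_sub_cancel' e1]; exact e3)
      refine ⟨t', g1, by omega, ?_⟩
      have : rmax d t' ≤ rmax d a := by
        obtain ⟨s, hs, hs'⟩ := rmax_att d t'
        rcases Nat.lt_or_ge s a with h | h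
        · have := le_rmax d a s h.le
          omega
        · have := g4 s h hs
          omega
      omega
    · push Not at hex
      refine ⟨t, h1, h2, ?_⟩
      have : rmax d t ≤ rmax d a := by
        obtain ⟨s, hs, hs'⟩ := rmax_att d t
        rcases Nat.lt_or_ge s a with h | h
        · have := le_rmax d a s h.le
          omega
        · have := hex s h hs
          omega
      have := rmax_mono d (le_trans h1 h2)
      omega

theorem pit_self (i : ℕ) (x : ℕ → ℕ → ℤ) (m : ℕ) :
    pit i x i m = x i m + rmax (fun s => x (i + 1) s - x i s) m := by simp [pit]
theorem pit_succ (i : ℕ) (x : ℕ → ℕ → ℤ) (m : ℕ) :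
    pit i x (i + 1) m = x (i + 1) m - rmax (fun s => x (i + 1) s - x i s) m := by simp [pit]
theorem pit_other (i : ℕ) (x : ℕ → ℕ → ℤ) (a m : ℕ) (h : a ≠ i) (h' : a ≠ i + 1) :
    pit i x a m = x a m := by simp [pit, h, h']

theorem pit_fix (i : ℕ) (x : ℕ → ℕ → ℤ) (h0 : ∀ i, x i 0 = 0)
    (h : ∀ m, x (i + 1) m ≤ x i m) : pit i x = x := by
  have key : ∀ m, rmax (fun s => x (i + 1) s - x i s) m = 0 := fun m =>
    rmax_eq _ _ _ (fun s _ => by have := h s; omega) ⟨0, by omega, by simp [h0]⟩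
  funext a m
  by_cases ha : a = i
  · subst ha; rw [pit_self, key]; simp
  · by_cases ha' : a = i + 1
    · subst ha'; rw [pit_succ, key]; simp
    · rw [pit_other _ _ _ _ ha ha']

theorem pit_idem (i : ℕ) {x : ℕ → ℕ → ℤ} (hx : IsWord x) : pit i (pit i x) = pit i x := by
  apply pit_fix _ _ (isWord_pit i hx).1
  intro m
  rw [pit_self, pit_succ]
  have := le_rmax (fun s => x (i + 1) s - x i s) m m le_rfl
  have := le_rmax (fun s => x (i + 1) s - x i s) m 0 (by omega)
  simp [hx.1] at *
  omega

theorem pit_comm (i j : ℕ) (h : i + 2 ≤ j) (x : ℕ → ℕ → ℤ) :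
    pit i (pit j x) = pit j (pit i x) := by
  have e1 : ∀ m, pit j x i m = x i m := fun m => pit_other _ _ _ _ (by omega) (by omega)
  have e2 : ∀ m, pit j x (i + 1) m = x (i + 1) m := fun m => pit_other _ _ _ _ (by omega) (by omega)
  have e3 : ∀ m, pit i x j m = x j m := fun m => pit_other _ _ _ _ (by omega) (by omega)
  have e4 : ∀ m, pit i x (j + 1) m = x (j + 1) m := fun m => pit_other _ _ _ _ (by omega) (by omega)
  funext a m
  by_cases h1 : a = i
  · subst h1; rw [pit_self, pit_other j (pit a x) _ _ (by omega) (by omega), pit_self]; simp only [e1, e2]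
  by_cases h2 : a = i + 1
  · subst h2; rw [pit_succ, pit_other j (pit i x) _ _ (by omega) (by omega), pit_succ]; simp only [e1, e2]
  by_cases h3 : a = j
  · subst h3; rw [pit_self, pit_other i _ _ _ (by omega) (by omega), pit_self]; simp only [e3, e4]
  by_cases h4 : a = j + 1
  · subst h4; rw [pit_succ, pit_other i _ _ _ (by omega) (by omega), pit_succ]; simp only [e3, e4]
  rw [pit_other i _ _ _ h1 h2, pit_other j _ _ _ h3 h4, pit_other j _ _ _ h3 h4,
    pit_other i _ _ _ h1 h2]

theorem pit_add (i : ℕ) (x : ℕ → ℕ → ℤ) (m : ℕ) :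
    pit i x i m + pit i x (i + 1) m = x i m + x (i + 1) m := by
  rw [pit_self, pit_succ]; ring

theorem pit_shf (i : ℕ) {x : ℕ → ℕ → ℤ} (hx : IsWord x) :
    pit i (shf (pit i x)) = pit i (shf x) := by
  have hstep := hx.step i
  have key : ∀ m, rmax (fun s => shf (pit i x) (i + 1) s - shf (pit i x) i s) m =
      rmax (fun s => shf x (i + 1) s - shf x i s) m
       - rmax (fun s => x (i + 1) s - x i s) (m + 1) + rmax (fun s => x (i + 1) s - x i s) 1 := by
    intro m
    apply rmax_eq
    · intro s hs
      obtain ⟨t, h1, h2, h3⟩ := iso_A (fun s => x (i + 1) s - x i s) 1 (m + 1) (s + 1)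
        (by omega) (by omega)
      have := le_rmax (fun s => shf x (i + 1) s - shf x i s) m (t - 1) (by omega)
      simp only [shf, pit_self, pit_succ, Nat.sub_add_cancel h1] at *
      omega
    · obtain ⟨s, hs, hs'⟩ := rmax_att (fun s => shf x (i + 1) s - shf x i s) m
      obtain ⟨t, h1, h2, h3⟩ := iso_B (fun s => x (i + 1) s - x i s) hstep 1 (m + 1) (s + 1)
        (by omega) (by omega)
      refine ⟨t - 1, by omega, ?_⟩
      obtain ⟨t', h1', h2', h3'⟩ := iso_A (fun s => x (i + 1) s - x i s) 1 (m + 1) t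
        h1 h2
      have := le_rmax (fun s => shf x (i + 1) s - shf x i s) m (t' - 1) (by omega)
      simp only [shf, pit_self, pit_succ, Nat.sub_add_cancel h1, Nat.sub_add_cancel h1'] at *
      omega
  funext a m
  by_cases ha : a = i
  · subst ha; rw [pit_self, pit_self, key]; simp only [shf, pit_self]; ring
  · by_cases ha' : a = i + 1
    · subst ha'; rw [pit_succ, pit_succ, key]; simp only [shf, pit_succ]; ring
    · rw [pit_other _ _ _ _ ha ha', pit_other _ _ _ _ ha ha']
      simp only [shf]
      rw [pit_other _ _ _ _ ha ha', pit_other _ _ _ _ ha ha']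

/-- value of the first coordinate -/
theorem pit_max1 (i : ℕ) (y : ℕ → ℕ → ℤ) (m : ℕ) :
    (∀ t s, s ≤ t → t ≤ m → y i m - y i t + y (i + 1) t - y (i + 1) s + y (i + 2) s
        ≤ pit i (pit (i + 1) y) i m) ∧
    (∃ t s, s ≤ t ∧ t ≤ m ∧ y i m - y i t + y (i + 1) t - y (i + 1) s + y (i + 2) s
        = pit i (pit (i + 1) y) i m) := by
  have e1 : ∀ m, pit (i + 1) y i m = y i m := fun m => pit_other _ _ _ _ (by omega) (by omega)
  constructor
  · intro t s hs ht
    rw [pit_self]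
    have h1 := le_rmax (fun s => pit (i + 1) y (i + 1) s - pit (i + 1) y i s) m t ht
    have h2 := le_rmax (fun s => y (i + 1 + 1) s - y (i + 1) s) t s hs
    simp only [e1, pit_self] at *
    have e : i + 1 + 1 = i + 2 := rfl
    simp only [e] at *
    omega
  · rw [pit_self]
    obtain ⟨t, ht, h1⟩ := rmax_att (fun s => pit (i + 1) y (i + 1) s - pit (i + 1) y i s) m
    obtain ⟨s, hs, h2⟩ := rmax_att (fun s => y (i + 1 + 1) s - y (i + 1) s) t
    refine ⟨t, s, hs, ht, ?_⟩
    simp only [e1, pit_self] at *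
    have e : i + 1 + 1 = i + 2 := rfl
    simp only [e] at *
    omega

theorem pit_min3 (i : ℕ) (y : ℕ → ℕ → ℤ) (m : ℕ) :
    (∀ t s, t ≤ s → s ≤ m → pit (i + 1) (pit i y) (i + 2) m ≤
       y i t + y (i + 1) s - y (i + 1) t + y (i + 2) m - y (i + 2) s) ∧
    (∃ t s, t ≤ s ∧ s ≤ m ∧ pit (i + 1) (pit i y) (i + 2) m =
       y i t + y (i + 1) s - y (i + 1) t + y (i + 2) m - y (i + 2) s) := by
  have e1 : ∀ m, pit i y (i + 2) m = y (i + 2) m :=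
    fun m => pit_other _ _ _ _ (by omega) (by omega)
  have e : i + 1 + 1 = i + 2 := rfl
  have e' := pit_succ (i + 1) (pit i y)
  rw [e] at e'
  constructor
  · intro t s hs ht
    rw [e']
    have h1 := le_rmax (fun s => pit i y (i + 2) s - pit i y (i + 1) s) m s ht
    have h2 := le_rmax (fun s => y (i + 1) s - y i s) s t hs
    simp only [e1, pit_succ] at *
    omega
  · rw [e']
    obtain ⟨s, ht, h1⟩ := rmax_att (fun s => pit i y (i + 2) s - pit i y (i + 1) s) m
    obtain ⟨t, hs, h2⟩ := rmax_att (fun s => y (i + 1) s - y i s) s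
    refine ⟨t, s, hs, ht, ?_⟩
    simp only [e1, pit_succ] at *
    omega

theorem braid1 (i : ℕ) {x : ℕ → ℕ → ℤ} (hx : IsWord x) (m : ℕ) :
    pit i (pit (i + 1) (pit i x)) i m = pit i (pit (i + 1) x) i m := by
  obtain ⟨u1, t1, s1, h1, h1', h1''⟩ := pit_max1 i x m
  obtain ⟨u2, t2, s2, h2, h2', h2''⟩ := pit_max1 i (pit i x) m
  have e1 : ∀ m, pit i x (i + 2) m = x (i + 2) m :=
    fun m => pit_other _ _ _ _ (by omega) (by omega)
  apply le_antisymm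
  · rw [← h2'']
    obtain ⟨t, g1, g2, g3⟩ := iso_A (fun s => x (i + 1) s - x i s) s2 m t2 h2 h2'
    have := u1 t s2 g1 g2
    simp only [e1, pit_self i x, pit_succ i x] at *
    omega
  · rw [← h1'']
    obtain ⟨t, g1, g2, g3⟩ := iso_B (fun s => x (i + 1) s - x i s) (hx.step i) s1 m t1 h1 h1'
    have := u2 t s1 g1 g2
    simp only [e1, pit_self i x, pit_succ i x] at *
    omega

theorem braid3 (i : ℕ) {x : ℕ → ℕ → ℤ} (hx : IsWord x) (m : ℕ) :
    pit (i + 1) (pit i (pit (i + 1) x)) (i + 2) m = pit (i + 1) (pit i x) (i + 2) m := by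
  obtain ⟨u1, t1, s1, h1, h1', h1''⟩ := pit_min3 i x m
  obtain ⟨u2, t2, s2, h2, h2', h2''⟩ := pit_min3 i (pit (i + 1) x) m
  have e1 : ∀ m, pit (i + 1) x i m = x i m :=
    fun m => pit_other _ _ _ _ (by omega) (by omega)
  have e' := pit_succ (i + 1) x
  have e : i + 1 + 1 = i + 2 := rfl
  rw [e] at e'
  apply le_antisymm
  · rw [h1'']
    obtain ⟨s, g1, g2, g3⟩ := iso_B (fun s => x (i + 2) s - x (i + 1) s) (hx.step (i + 1)) t1 m s1 h1 h1'
    have := u2 t1 s g1 g2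
    simp only [e1, pit_self (i + 1) x, e', e] at *
    omega
  · rw [h2'']
    obtain ⟨s, g1, g2, g3⟩ := iso_A (fun s => x (i + 2) s - x (i + 1) s) t2 m s2 h2 h2'
    have := u1 t2 s g1 g2
    simp only [e1, pit_self (i + 1) x, e', e] at *
    omega

theorem braid (i : ℕ) {x : ℕ → ℕ → ℤ} (hx : IsWord x) :
    pit i (pit (i + 1) (pit i x)) = pit (i + 1) (pit i (pit (i + 1) x)) := by
  have E1 : ∀ m, pit i (pit (i + 1) (pit i x)) i m = pit (i + 1) (pit i (pit (i + 1) x)) i m := by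
    intro m
    rw [braid1 i hx, pit_other (i + 1) _ i m (by omega) (by omega)]
  have E3 : ∀ m, pit i (pit (i + 1) (pit i x)) (i + 2) m
      = pit (i + 1) (pit i (pit (i + 1) x)) (i + 2) m := by
    intro m
    rw [braid3 i hx, pit_other i _ (i + 2) m (by omega) (by omega)]
  have A : ∀ (y : ℕ → ℕ → ℤ) m, pit i y i m + pit i y (i + 1) m + pit i y (i + 2) m
      = y i m + y (i + 1) m + y (i + 2) m := by
    intro y m
    have := pit_add i y m
    have := pit_other i y (i + 2) m (by omega) (by omega)
    omega
  have A' : ∀ (y : ℕ → ℕ → ℤ) m, pit (i + 1) y i m + pit (i + 1) y (i + 1) m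
      + pit (i + 1) y (i + 2) m = y i m + y (i + 1) m + y (i + 2) m := by
    intro y m
    have := pit_add (i + 1) y m
    have e : i + 1 + 1 = i + 2 := rfl
    rw [e] at this
    have := pit_other (i + 1) y i m (by omega) (by omega)
    omega
  funext a m
  by_cases h1 : a = i
  · subst h1; exact E1 m
  by_cases h3 : a = i + 2
  · subst h3; exact E3 m
  by_cases h2 : a = i + 1
  · subst h2
    have := E1 m
    have := E3 m
    have := A (pit (i + 1) (pit i x)) m
    have := A' (pit i x) m
    have := A x m
    have := A' (pit i (pit (i + 1) x)) m
    have := A (pit (i + 1) x) m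
    have := A' x m
    omega
  rw [pit_other i _ a m (by omega) (by omega), pit_other (i + 1) _ a m (by omega) (by omega),
    pit_other i _ a m (by omega) (by omega), pit_other (i + 1) _ a m (by omega) (by omega),
    pit_other i _ a m (by omega) (by omega), pit_other (i + 1) _ a m (by omega) (by omega)]

/-- `P_{j-1} ... P_0` -/
def dd : ℕ → (ℕ → ℕ → ℤ) → (ℕ → ℕ → ℤ)
  | 0, x => x
  | j + 1, x => pit j (dd j x)

def phi : ℕ → (ℕ → ℕ → ℤ) → (ℕ → ℕ → ℤ)
  | 0, x => x
  | j + 1, x => phi j (dd (j + 1) x)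

theorem isWord_dd (j : ℕ) {x : ℕ → ℕ → ℤ} (hx : IsWord x) : IsWord (dd j x) := by
  induction j with
  | zero => exact hx
  | succ j ih => exact isWord_pit j ih

theorem dd_comm (j i : ℕ) (h : j < i) (x : ℕ → ℕ → ℤ) : dd j (pit i x) = pit i (dd j x) := by
  induction j with
  | zero => rfl
  | succ j ih =>
    simp only [dd]
    rw [ih (by omega), pit_comm j i (by omega)]

theorem dd_zero (j : ℕ) {x : ℕ → ℕ → ℤ} (hx : IsWord x) : dd (j + 1) (pit 0 x) = dd (j + 1) x := by
  induction j with
  | zero => exact pit_idem 0 hx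
  | succ j ih => rw [dd, ih]; rfl

theorem dd_succ (j i : ℕ) (h : i + 1 < j) {x : ℕ → ℕ → ℤ} (hx : IsWord x) :
    dd j (pit (i + 1) x) = pit i (dd j x) := by
  induction j with
  | zero => omega
  | succ j ih =>
    rcases Nat.lt_or_ge (i + 1) j with h' | h'
    · simp only [dd]
      rw [ih h', pit_comm i j (by omega)]
    · obtain rfl : j = i + 1 := by omega
      simp only [dd]
      rw [dd_comm i (i + 1) (by omega), braid i (isWord_dd i hx)]

theorem phi_pit (j : ℕ) : ∀ (i : ℕ), i < j → ∀ {x : ℕ → ℕ → ℤ}, IsWord x →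
    phi j (pit i x) = phi j x := by
  induction j with
  | zero => intro i h; omega
  | succ j ih =>
    intro i hi x hx
    simp only [phi]
    rcases i with _ | i
    · rw [dd_zero j hx]
    · rw [dd_succ (j + 1) i hi hx, ih i (by omega) (isWord_dd _ hx)]

theorem phi_shf_pit (j i : ℕ) (h : i < j) {x : ℕ → ℕ → ℤ} (hx : IsWord x) :
    phi j (shf (pit i x)) = phi j (shf x) := by
  rw [← phi_pit j i h (isWord_shf (isWord_pit i hx)), pit_shf i hx, phi_pit j i h (isWord_shf hx)]

theorem isWord_shf_iter (N : ℕ) {x : ℕ → ℕ → ℤ} (hx : IsWord x) : IsWord (shf^[N] x) := by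
  induction N with
  | zero => exact hx
  | succ N ih => rw [Function.iterate_succ_apply']; exact isWord_shf ih

theorem phi_shf_iter_pit (j i : ℕ) (h : i < j) (N : ℕ) : ∀ {x : ℕ → ℕ → ℤ}, IsWord x →
    phi j (shf^[N] (pit i x)) = phi j (shf^[N] x) := by
  intro x hx
  suffices H : ∀ N, IsWord (shf^[N] (pit i x)) ∧
      pit i (shf^[N] (pit i x)) = pit i (shf^[N] x) by
    rw [← phi_pit j i h (H N).1, (H N).2, phi_pit j i h (isWord_shf_iter N hx)]
  intro N
  refine ⟨isWord_shf_iter N (isWord_pit i hx), ?_⟩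
  induction N with
  | zero => exact pit_idem i hx
  | succ N ih =>
    rw [Function.iterate_succ_apply', Function.iterate_succ_apply',
      ← pit_shf i (isWord_shf_iter N (isWord_pit i hx)), ih, pit_shf i (isWord_shf_iter N hx)]

theorem phi_shf_iter_dd (j i : ℕ) (h : i ≤ j) (N : ℕ) {x : ℕ → ℕ → ℤ} (hx : IsWord x) :
    phi j (shf^[N] (dd i x)) = phi j (shf^[N] x) := by
  induction i with
  | zero => rfl
  | succ i ih =>
    rw [dd, phi_shf_iter_pit j i (by omega) N (isWord_dd i hx), ih (by omega)]

theorem dd_fix (j : ℕ) {x : ℕ → ℕ → ℤ} (h0 : ∀ i, x i 0 = 0)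
    (h : ∀ i m, x (i + 1) m ≤ x i m) : dd j x = x := by
  induction j with
  | zero => rfl
  | succ j ih => rw [dd, ih, pit_fix j x h0 (h j)]

theorem phi_fix (j : ℕ) {x : ℕ → ℕ → ℤ} (h0 : ∀ i, x i 0 = 0)
    (h : ∀ i m, x (i + 1) m ≤ x i m) : phi j x = x := by
  induction j with
  | zero => rfl
  | succ j ih => rw [phi, dd_fix (j + 1) h0 h, ih]

/-- number of entries `≤ m` in row `i` -/
noncomputable def cnt (T : ℕ × ℕ → ℕ) (i : ℕ) : ℕ → ℕ
  | 0 => 0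
  | m + 1 => cnt T i m + if ∃ j, T (i, j) = m + 1 then 1 else 0

theorem cnt_mono (T : ℕ × ℕ → ℕ) (i : ℕ) {a b : ℕ} (h : a ≤ b) : cnt T i a ≤ cnt T i b := by
  induction b, h using Nat.le_induction with
  | base => exact le_rfl
  | succ b _ ih => exact le_trans ih (Nat.le_add_right _ _)

theorem box_iff (l : ℕ) (b : ℕ × ℕ) : Box (l : ℕ∞) b ↔ b.1 < l := by
  unfold Box; exact Nat.cast_lt

section tab
variable {l : ℕ} {T : ℕ × ℕ → ℕ}

theorem IsSYT.out (hT : IsSYT (l : ℕ∞) T) {i : ℕ} (j : ℕ) (h : l ≤ i) : T (i, j) = 0 :=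
  hT.zero_outside _ (by rw [box_iff]; simpa using h)
theorem IsSYT.pos' (hT : IsSYT (l : ℕ∞) T) {i : ℕ} (j : ℕ) (h : i < l) : 0 < T (i, j) :=
  hT.pos _ (by rw [box_iff]; simpa using h)
theorem IsSYT.row' (hT : IsSYT (l : ℕ∞) T) {i : ℕ} (j : ℕ) (h : i < l) :
    T (i, j) < T (i, j + 1) :=
  hT.row_lt (i, j) (by rw [box_iff]; simpa using h)
theorem IsSYT.col' (hT : IsSYT (l : ℕ∞) T) {i : ℕ} (j : ℕ) (h : i + 1 < l) :
    T (i, j) < T (i + 1, j) :=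
  hT.col_lt (i, j) (by rw [box_iff]; simpa using h)
theorem IsSYT.inj' (hT : IsSYT (l : ℕ∞) T) {b c : ℕ × ℕ} (hb : b.1 < l) (h : T b = T c) :
    b = c := by
  have h0 := hT.pos b ((box_iff l b).2 hb)
  refine hT.inj b c ((box_iff l b).2 hb) ?_ h
  by_contra hc
  have := hT.zero_outside c hc
  omega
theorem IsSYT.surj' (hT : IsSYT (l : ℕ∞) T) (n : ℕ) (h : 0 < n) : ∃ i j, i < l ∧ T (i, j) = n := by
  obtain ⟨⟨i, j⟩, hb, h⟩ := hT.surj n h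
  exact ⟨i, j, by rw [box_iff] at hb; exact hb, h⟩

theorem IsSYT.strict (hT : IsSYT (l : ℕ∞) T) {i : ℕ} (h : i < l) :
    StrictMono (fun j => T (i, j)) :=
  strictMono_nat_of_lt_succ (fun j => hT.row' j h)

theorem IsSYT.one (hT : IsSYT (l : ℕ∞) T) {i j : ℕ} (h : i < l) (h1 : T (i, j) ≤ 1) :
    i = 0 ∧ j = 0 := by
  constructor
  · rcases i with _ | i
    · rfl
    · have := hT.col' j h
      have := hT.pos' (i := i) j (by omega)
      omega
  · rcases j with _ | j
    · rfl
    · have := hT.row' j h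
      have := hT.pos' j h
      omega

theorem IsSYT.zz (hT : IsSYT (l : ℕ∞) T) : T (0, 0) = 1 := by
  obtain ⟨i, j, h, e⟩ := hT.surj' 1 (by omega)
  obtain ⟨rfl, rfl⟩ := hT.one h e.le
  exact e

theorem IsSYT.lt_cnt (hT : IsSYT (l : ℕ∞) T) {i : ℕ} (h : i < l) (m : ℕ) :
    ∀ j, T (i, j) ≤ m ↔ j < cnt T i m := by
  induction m with
  | zero => intro j; have := hT.pos' j h; simp only [cnt]; omega
  | succ m ih =>
    intro j
    simp only [cnt]
    split_ifs with hex
    · obtain ⟨j0, h0⟩ := hex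
      have e : j0 = cnt T i m := by
        have h1 := ih j0
        have h2 := ih (cnt T i m)
        rcases lt_trichotomy j0 (cnt T i m) with h3 | h3 | h3
        · omega
        · exact h3
        · have : T (i, cnt T i m) < T (i, j0) := hT.strict h h3
          omega
      have h1 := ih j
      rcases lt_trichotomy j j0 with h3 | h3 | h3
      · omega
      · subst h3; omega
      · have : T (i, j0) < T (i, j) := hT.strict h h3
        omega
    · have : T (i, j) ≠ m + 1 := fun h2 => hex ⟨j, h2⟩
      have h1 := ih j
      omega

theorem IsSYT.cnt_out (hT : IsSYT (l : ℕ∞) T) {i : ℕ} (h : l ≤ i) (m : ℕ) : cnt T i m = 0 := by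
  induction m with
  | zero => rfl
  | succ m ih =>
    simp only [cnt, ih]
    rw [if_neg]
    rintro ⟨j, hj⟩
    rw [hT.out j h] at hj
    omega

theorem IsSYT.cnt_at (hT : IsSYT (l : ℕ∞) T) {i : ℕ} (h : i < l) {m q : ℕ}
    (h1 : T (i, q) ≤ m) (h2 : m < T (i, q + 1)) : cnt T i m = q + 1 := by
  have a := hT.lt_cnt h m q
  have b := hT.lt_cnt h m (q + 1)
  omega

theorem IsSYT.cnt_lat (hT : IsSYT (l : ℕ∞) T) (i m : ℕ) : cnt T (i + 1) m ≤ cnt T i m := by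
  rcases Nat.lt_or_ge (i + 1) l with h | h
  · by_contra hc
    push Not at hc
    have h1 := (hT.lt_cnt h m (cnt T i m)).2 hc
    have h2 := hT.col' (cnt T i m) h
    have h3 := hT.lt_cnt (i := i) (by omega) m (cnt T i m)
    omega
  · rw [hT.cnt_out h]; omega

theorem IsSYT.ext_cnt {T' : ℕ × ℕ → ℕ} (hT : IsSYT (l : ℕ∞) T) (hT' : IsSYT (l : ℕ∞) T')
    (h : ∀ i m, cnt T i m = cnt T' i m) : T = T' := by
  funext ⟨i, j⟩
  rcases Nat.lt_or_ge i l with hi | hi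
  · apply le_antisymm
    · rw [hT.lt_cnt hi, h, ← hT'.lt_cnt hi]
    · rw [hT'.lt_cnt hi, ← h, ← hT.lt_cnt hi]
  · rw [hT.out j hi, hT'.out j hi]

/-- integer counting path -/
noncomputable def cz (T : ℕ × ℕ → ℕ) : ℕ → ℕ → ℤ := fun i m => (cnt T i m : ℤ)

theorem IsSYT.cz_word (hT : IsSYT (l : ℕ∞) T) : IsWord (cz T) := by
  refine ⟨fun i => rfl, fun m => ?_⟩
  obtain ⟨r, j, hr, e⟩ := hT.surj' (m + 1) (by omega)
  refine ⟨r, fun i => ?_⟩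
  simp only [cz, cnt]
  by_cases h : i = r
  · subst h
    rw [if_pos ⟨j, e⟩, if_pos rfl]; push_cast; ring
  · rw [if_neg, if_neg h]; · push_cast; ring
    rintro ⟨j', hj'⟩
    have := hT.inj' (b := (r, j)) (c := (i, j')) hr (by rw [e, hj'])
    simp at this
    exact h this.1.symm

/-- the path -/
noncomputable def pth (l : ℕ) (T : ℕ × ℕ → ℕ) (n : ℕ) : ℕ × ℕ := slide (Box (l : ℕ∞)) T n

theorem pth_zero : pth l T 0 = (0, 0) := rfl

theorem pth_row (hl : 1 ≤ l) (n : ℕ) : (pth l T n).1 < l := by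
  induction n with
  | zero => rw [pth_zero]; exact hl
  | succ n ih =>
    unfold pth slide at *
    simp only [slideFrom, box_iff]
    split_ifs <;> simp_all

theorem pth_succ (hl : 1 ≤ l) (n : ℕ) {i j : ℕ} (h : pth l T n = (i, j)) :
    pth l T (n + 1) = if i + 1 < l ∧ T (i + 1, j) < T (i, j + 1) then (i + 1, j) else (i, j + 1) := by
  have hr := pth_row (T := T) hl n
  rw [h] at hr
  unfold pth slide at *
  simp only [slideFrom, box_iff, h]
  split_ifs <;> simp_all

theorem pth_sum (hl : 1 ≤ l) (n : ℕ) : (pth l T n).1 + (pth l T n).2 = n := by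
  induction n with
  | zero => rfl
  | succ n ih =>
    rw [pth_succ hl n (i := (pth l T n).1) (j := (pth l T n).2) rfl]
    split_ifs <;> simp only <;> omega

/-- on the path -/
def onp (l : ℕ) (T : ℕ × ℕ → ℕ) (i j : ℕ) : Prop := pth l T (i + j) = (i, j)

theorem onp_of (hl : 1 ≤ l) {n i j : ℕ} (h : pth l T n = (i, j)) : onp l T i j := by
  have := pth_sum (T := T) hl n
  rw [h] at this
  unfold onp
  simp only at this
  rw [this, h]

theorem onp_row (hl : 1 ≤ l) {i j : ℕ} (h : onp l T i j) : i < l := by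
  have := pth_row (T := T) hl (i + j)
  rw [h] at this
  exact this

theorem onp_zero : onp l T 0 0 := rfl

theorem onp_next (hl : 1 ≤ l) {i j : ℕ} (h : onp l T i j) :
    (i + 1 < l ∧ T (i + 1, j) < T (i, j + 1) ∧ pth l T (i + j + 1) = (i + 1, j)) ∨
    ((i + 1 < l → T (i, j + 1) ≤ T (i + 1, j)) ∧ pth l T (i + j + 1) = (i, j + 1)) := by
  have := pth_succ hl _ h
  split_ifs at this with hc
  · exact Or.inl ⟨hc.1, hc.2, this⟩
  · refine Or.inr ⟨fun h1 => ?_, this⟩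
    by_contra h2
    exact hc ⟨h1, by omega⟩

theorem onp_prev (hl : 1 ≤ l) {i j : ℕ} (h : onp l T i j) (h0 : 0 < i + j) :
    (∃ i', i = i' + 1 ∧ onp l T i' j) ∨ (∃ j', j = j' + 1 ∧ onp l T i j') := by
  obtain ⟨n, hn⟩ : ∃ n, i + j = n + 1 := ⟨i + j - 1, by omega⟩
  have h1 : pth l T (n + 1) = (i, j) := by rw [← hn]; exact h
  rcases hp : pth l T n with ⟨a, b⟩
  rw [pth_succ hl n hp] at h1
  have := onp_of hl hp
  split_ifs at h1
  · simp at h1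
    obtain ⟨rfl, rfl⟩ := h1
    exact Or.inl ⟨a, rfl, this⟩
  · simp at h1
    obtain ⟨rfl, rfl⟩ := h1
    exact Or.inr ⟨b, rfl, this⟩

theorem jdt_off {i j : ℕ} (h : ¬ onp l T i j) : jdt (Box (l : ℕ∞)) T (i, j) = T (i, j) - 1 := by
  unfold jdt
  exact if_neg h

theorem jdt_on (hl : 1 ≤ l) {i j : ℕ} (h : onp l T i j) :
    jdt (Box (l : ℕ∞)) T (i, j) = T (pth l T (i + j + 1)) - 1 := by
  unfold jdt
  have h1 : slide (Box (l : ℕ∞)) T (i + j) = (i, j) := h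
  simp only [h1, if_true]
  rw [if_neg]
  · rfl
  · intro h2
    have := pth_sum (T := T) hl (i + j + 1)
    unfold pth at this
    rw [h2] at this
    simp at this

theorem onp_lt (hl : 1 ≤ l) (hT : IsSYT (l : ℕ∞) T) {i j : ℕ} (h : onp l T i j) :
    T (i, j) < T (pth l T (i + j + 1)) := by
  have hr := onp_row hl h
  rcases onp_next hl h with ⟨h1, _, h3⟩ | ⟨_, h3⟩
  · rw [h3]; exact hT.col' j h1
  · rw [h3]; exact hT.row' j hr

theorem isSYT_jdt (hl : 1 ≤ l) (hT : IsSYT (l : ℕ∞) T) :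
    IsSYT (l : ℕ∞) (jdt (Box (l : ℕ∞)) T) := by
  refine ⟨?_, ?_, ?_, ?_, ?_, ?_⟩
  · rintro ⟨i, j⟩ hb
    have e := hT.zero_outside _ hb
    rw [box_iff] at hb
    rw [jdt_off (fun h => hb (onp_row hl h)), e]
  · rintro ⟨i, j⟩ hb
    rw [box_iff] at hb
    simp only at hb
    have hp := hT.pos' j hb
    by_cases h : onp l T i j
    · rw [jdt_on hl h]
      have := onp_lt hl hT h
      omega
    · rw [jdt_off h]
      by_contra hc
      obtain ⟨rfl, rfl⟩ := hT.one hb (show T (i, j) ≤ 1 by omega)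
      exact h onp_zero
  · rintro ⟨i, j⟩ ⟨i', j'⟩ hb hc e
    rw [box_iff] at hb hc
    simp only at hb hc
    have hp := hT.pos' j hb
    have hp' := hT.pos' j' hc
    by_cases h : onp l T i j <;> by_cases h' : onp l T i' j'
    · rw [jdt_on hl h, jdt_on hl h'] at e
      have l1 := onp_lt hl hT h
      have l2 := onp_lt hl hT h'
      have := hT.inj' (pth_row hl _) (show T (pth l T (i + j + 1)) = T (pth l T (i' + j' + 1)) by omega)
      have s1 := pth_sum (T := T) hl (i + j + 1)
      have s2 := pth_sum (T := T) hl (i' + j' + 1)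
      rw [this, s2] at s1
      rw [← h, ← h', show i' + j' = i + j by omega]
    · rw [jdt_on hl h, jdt_off h'] at e
      have l1 := onp_lt hl hT h
      have := hT.inj' (pth_row hl _) (show T (pth l T (i + j + 1)) = T (i', j') by omega)
      exact absurd (onp_of hl this) h'
    · rw [jdt_on hl h', jdt_off h] at e
      have l1 := onp_lt hl hT h'
      have := hT.inj' (pth_row hl _) (show T (pth l T (i' + j' + 1)) = T (i, j) by omega)
      exact absurd (onp_of hl this) h
    · rw [jdt_off h, jdt_off h'] at e
      exact hT.inj' hb (by omega)
  · intro n hn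
    obtain ⟨i, j, hi, e⟩ := hT.surj' (n + 1) (by omega)
    by_cases h : onp l T i j
    · have h0 : 0 < i + j := by
        by_contra hc
        obtain ⟨rfl, rfl⟩ : i = 0 ∧ j = 0 := by omega
        rw [hT.zz] at e
        omega
      rcases onp_prev hl h h0 with ⟨a, rfl, ha⟩ | ⟨a, rfl, ha⟩
      · refine ⟨(a, j), by rw [box_iff]; exact onp_row hl ha, ?_⟩
        rw [jdt_on hl ha, show a + j + 1 = a + 1 + j by omega, h, e]; rfl
      · refine ⟨(i, a), by rw [box_iff]; exact onp_row hl ha, ?_⟩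
        rw [jdt_on hl ha, show i + a + 1 = i + (a + 1) by omega, h, e]; rfl
    · exact ⟨(i, j), by rw [box_iff]; exact hi, by rw [jdt_off h, e]; rfl⟩
  · rintro ⟨i, j⟩ hb
    rw [box_iff] at hb
    simp only at hb ⊢
    have hp := hT.pos' j hb
    have hr := hT.row' j hb
    by_cases h' : onp l T i (j + 1)
    · have l2 := onp_lt hl hT h'
      rw [jdt_on hl h']
      by_cases h : onp l T i j
      · rw [jdt_on hl h, show i + j + 1 = i + (j + 1) by omega, h']
        rw [← Nat.add_assoc] at *
        omega
      · rw [jdt_off h]; omega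
    · rw [jdt_off h']
      by_cases h : onp l T i j
      · have l1 := onp_lt hl hT h
        rw [jdt_on hl h]
        rcases onp_next hl h with ⟨h1, h2, h3⟩ | ⟨_, h3⟩
        · rw [h3] at *; omega
        · exact absurd (onp_of hl h3) h'
      · rw [jdt_off h]; omega
  · rintro ⟨i, j⟩ hb
    rw [box_iff] at hb
    simp only at hb ⊢
    have hp := hT.pos' (i := i) j (by omega)
    have hr := hT.col' j hb
    by_cases h' : onp l T (i + 1) j
    · have l2 := onp_lt hl hT h'
      rw [jdt_on hl h']
      by_cases h : onp l T i j
      · rw [jdt_on hl h, show i + j + 1 = i + 1 + j by omega, h']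
        omega
      · rw [jdt_off h]; omega
    · rw [jdt_off h']
      by_cases h : onp l T i j
      · have l1 := onp_lt hl hT h
        rw [jdt_on hl h]
        rcases onp_next hl h with ⟨h1, h2, h3⟩ | ⟨h2, h3⟩
        · exact absurd (onp_of hl h3) h'
        · have := h2 hb
          rw [h3] at *
          have : T (i, j + 1) ≠ T (i + 1, j) := fun e => by
            have := hT.inj' (b := (i, j + 1)) (show i < l by omega) e
            simp at this
          omega
      · rw [jdt_off h]; omega

/-- the hole has entered row `i` by time `m` -/
noncomputable def hh (l : ℕ) (T : ℕ × ℕ → ℕ) (i m : ℕ) : ℤ :=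
  if ∃ j, onp l T i j ∧ T (i, j) ≤ m then 1 else 0

theorem hh_one {i m j : ℕ} (h : onp l T i j) (h' : T (i, j) ≤ m) : hh l T i m = 1 :=
  if_pos ⟨j, h, h'⟩

theorem hh_zero {i m : ℕ} (h : ∀ j, onp l T i j → m < T (i, j)) : hh l T i m = 0 := by
  apply if_neg
  rintro ⟨j, h1, h2⟩
  have := h j h1
  omega

theorem hh_same {i m m' : ℕ} (hm : m ≤ m') (h : ∀ j, onp l T i j → T (i, j) ≤ m' →
    ∃ j', onp l T i j' ∧ T (i, j') ≤ m) : hh l T i m' = hh l T i m := by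
  unfold hh
  congr 1
  apply propext
  constructor
  · rintro ⟨j, h1, h2⟩; exact h j h1 h2
  · rintro ⟨j, h1, h2⟩; exact ⟨j, h1, by omega⟩

theorem hh_cases (i m : ℕ) : (hh l T i m = 0 ∧ ∀ j, onp l T i j → m < T (i, j)) ∨
    (hh l T i m = 1 ∧ ∃ j, onp l T i j ∧ T (i, j) ≤ m) := by
  by_cases h : ∃ j, onp l T i j ∧ T (i, j) ≤ m
  · exact Or.inr ⟨if_pos h, h⟩
  · refine Or.inl ⟨if_neg h, fun j hj => ?_⟩
    by_contra hc
    exact h ⟨j, hj, by omega⟩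

theorem pth_mono (hl : 1 ≤ l) {n n' : ℕ} (h : n ≤ n') : (pth l T n).1 ≤ (pth l T n').1 := by
  induction n', h using Nat.le_induction with
  | base => exact le_rfl
  | succ b _ ih =>
    refine le_trans ih ?_
    rw [pth_succ hl b (i := (pth l T b).1) (j := (pth l T b).2) rfl]
    split_ifs <;> simp

theorem cnt_step (hT : IsSYT (l : ℕ∞) T) {r c m : ℕ} (h : T (r, c) = m + 1) (i : ℕ) :
    cnt T i (m + 1) = cnt T i m + if i = r then 1 else 0 := by
  simp only [cnt]
  by_cases hi : i = r
  · subst hi; rw [if_pos ⟨c, h⟩, if_pos rfl]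
  · rw [if_neg, if_neg hi]
    rintro ⟨j, hj⟩
    have hr : r < l := by
      by_contra hc
      rw [hT.out c (by omega)] at h
      omega
    have := hT.inj' (b := (r, c)) (c := (i, j)) hr (by rw [h, hj])
    simp at this
    exact hi this.1.symm

theorem cnt_one (hT : IsSYT (l : ℕ∞) T) (i : ℕ) : cnt T i 1 = if i = 0 then 1 else 0 := by
  rw [cnt_step hT hT.zz i]; simp [cnt]

theorem hh_init (hl : 1 ≤ l) (hT : IsSYT (l : ℕ∞) T) (i : ℕ) :
    hh l T i 1 = if i = 0 then 1 else 0 := by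
  split_ifs with h
  · subst h; exact hh_one onp_zero hT.zz.le
  · apply hh_zero
    intro j hj
    by_contra hc
    exact h (hT.one (j := j) (onp_row hl hj) (by omega)).1

theorem link_cnt (hl : 1 ≤ l) (hT : IsSYT (l : ℕ∞) T) (m : ℕ) : ∀ i,
    (cnt (jdt (Box (l : ℕ∞)) T) i m : ℤ)
      = cnt T i (m + 1) - hh l T i (m + 1) + hh l T (i + 1) (m + 1) := by
  have hJ := isSYT_jdt hl hT
  induction m with
  | zero =>
    intro i
    rw [Nat.zero_add, hh_init hl hT, hh_init hl hT, cnt_one hT]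
    simp [cnt]
  | succ m ih =>
    intro i
    obtain ⟨r, c, hr, e⟩ := hT.surj' (m + 1 + 1) (by omega)
    have ihi := ih i
    have ce := cnt_step hT e i
    have uniq : ∀ i j, T (i, j) = m + 1 + 1 → i = r ∧ j = c := by
      intro i j h
      have := hT.inj' (b := (r, c)) (c := (i, j)) hr (by rw [e, h])
      simp at this
      exact ⟨this.1.symm, this.2.symm⟩
    by_cases hon : onp l T r c
    · rcases onp_prev hl hon (by
        by_contra hc
        obtain ⟨rfl, rfl⟩ : r = 0 ∧ c = 0 := by omega
        rw [hT.zz] at e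
        omega) with ⟨a, rfl, ha⟩ | ⟨a, rfl, ha⟩
      · have je : jdt (Box (l : ℕ∞)) T (a, c) = m + 1 := by
          rw [jdt_on hl ha, show a + c + 1 = a + 1 + c by omega, hon, e]; rfl
        have ce' := cnt_step hJ je i
        have hs : ∀ i, i ≠ a + 1 → hh l T i (m + 1 + 1) = hh l T i (m + 1) := by
          intro i hi
          apply hh_same (by omega)
          intro j h1 h2
          refine ⟨j, h1, ?_⟩
          by_contra h3
          exact hi (uniq i j (by omega)).1
        have h1 : hh l T (a + 1) (m + 1 + 1) = 1 := hh_one hon (by omega)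
        have h0 : hh l T (a + 1) (m + 1) = 0 := by
          apply hh_zero
          intro j hj
          by_contra hc
          have hjc : j < c := by
            by_contra h4
            have : T (a + 1, c) ≤ T (a + 1, j) := (hT.strict hr).monotone (show c ≤ j by omega)
            omega
          have := pth_mono (T := T) hl (show a + 1 + j ≤ a + c by omega)
          rw [hj, ha] at this
          simp only at this
          omega
        by_cases h2 : i = a + 1
        · subst h2
          have := hs (a + 1 + 1) (by omega)
          simp at ce ce'
          rw [ce, ce']; push_cast
          omega
        · by_cases h3 : i = a
          · subst h3
            have := hs i (by omega)
            simp at ce ce'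
            rw [ce, ce']; push_cast
            omega
          · have := hs i h2
            have := hs (i + 1) (by omega)
            simp [h2, h3] at ce ce'
            rw [ce, ce']
            omega
      · have je : jdt (Box (l : ℕ∞)) T (r, a) = m + 1 := by
          rw [jdt_on hl ha, show r + a + 1 = r + (a + 1) by omega, hon, e]; rfl
        have ce' := cnt_step hJ je i
        have hs : ∀ i, hh l T i (m + 1 + 1) = hh l T i (m + 1) := by
          intro i
          apply hh_same (by omega)
          intro j h1 h2
          by_cases h3 : T (i, j) ≤ m + 1
          · exact ⟨j, h1, h3⟩
          · obtain ⟨rfl, rfl⟩ := uniq i j (by omega)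
            have := hT.row' a hr
            exact ⟨a, ha, by omega⟩
        rw [ce, ce', hs, hs]; push_cast
        omega
    · have je : jdt (Box (l : ℕ∞)) T (r, c) = m + 1 := by
        rw [jdt_off hon, e]; rfl
      have ce' := cnt_step hJ je i
      have hs : ∀ i, hh l T i (m + 1 + 1) = hh l T i (m + 1) := by
        intro i
        apply hh_same (by omega)
        intro j h1 h2
        by_cases h3 : T (i, j) ≤ m + 1
        · exact ⟨j, h1, h3⟩
        · obtain ⟨rfl, rfl⟩ := uniq i j (by omega)
          exact absurd h1 hon
      rw [ce, ce', hs, hs]; push_cast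
      omega

theorem path_exit (hl : 1 ≤ l) (hT : IsSYT (l : ℕ∞) T) {j q s : ℕ} (hj : j + 1 < l)
    (h1 : T (j + 1, q) ≤ s) (h2 : s < T (j, q + 1)) : ∀ u c, c + u = q → onp l T j c →
    ∃ e, onp l T (j + 1) e ∧ T (j + 1, e) ≤ s := by
  intro u
  induction u with
  | zero =>
    intro c hc hon
    obtain rfl : c = q := by omega
    rcases onp_next hl hon with ⟨_, _, g⟩ | ⟨g, _⟩
    · exact ⟨c, onp_of hl g, h1⟩
    · have := g hj
      omega
  | succ u ih =>
    intro c hc hon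
    rcases onp_next hl hon with ⟨_, _, g⟩ | ⟨_, g⟩
    · refine ⟨c, onp_of hl g, ?_⟩
      have : T (j + 1, c) ≤ T (j + 1, q) := (hT.strict hj).monotone (show c ≤ q by omega)
      omega
    · exact ih (c + 1) (by omega) (onp_of hl g)

theorem hole_rmax (hl : 1 ≤ l) (hT : IsSYT (l : ℕ∞) T) {j : ℕ} (hj : j + 1 < l) (m : ℕ) :
    rmax (fun s => (cnt T (j + 1) (s + 1) : ℤ) - (cnt T j (s + 1) - hh l T j (s + 1))) m
      = hh l T (j + 1) (m + 1) := by
  apply rmax_eq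
  · intro s hs
    have hlat := hT.cnt_lat j (s + 1)
    rcases hh_cases (l := l) (T := T) (j + 1) (m + 1) with ⟨e, h⟩ | ⟨e, h⟩
    · rw [e]
      rcases hh_cases (l := l) (T := T) j (s + 1) with ⟨e', h'⟩ | ⟨e', c, hc, hc'⟩
      · rw [e']; omega
      · rw [e']
        by_contra hcon
        have heq : cnt T (j + 1) (s + 1) = cnt T j (s + 1) := by omega
        have hcq := (hT.lt_cnt (i := j) (by omega) (s + 1) c).1 hc'
        obtain ⟨q, hq⟩ : ∃ q, cnt T j (s + 1) = q + 1 := ⟨cnt T j (s + 1) - 1, by omega⟩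
        have g1 := (hT.lt_cnt hj (s + 1) q).2 (by omega)
        have g2 := hT.lt_cnt (i := j) (by omega) (s + 1) (q + 1)
        obtain ⟨e2, he, he'⟩ := path_exit hl hT hj g1 (by omega) (q - c) c (by omega) hc
        have := h e2 he
        omega
    · rw [e]
      rcases hh_cases (l := l) (T := T) j (s + 1) with ⟨e', h'⟩ | ⟨e', h'⟩ <;> rw [e'] <;> omega
  · rcases hh_cases (l := l) (T := T) (j + 1) (m + 1) with ⟨e, h⟩ | ⟨e, h⟩
    · refine ⟨0, by omega, ?_⟩
      rw [e]
      simp only [Nat.zero_add, hh_init hl hT, cnt_one hT]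
      split_ifs <;> simp_all
    · rw [e]
      have h0 := Nat.find_spec h
      have hmin := fun q => Nat.find_min (H := h) (m := q)
      generalize Nat.find h = q at h0 hmin
      obtain ⟨hq, hq'⟩ := h0
      have hpos := hT.pos' q hj
      rcases onp_prev hl hq (by omega) with ⟨a, ha, ha'⟩ | ⟨a, ha, ha'⟩
      · obtain rfl : a = j := by omega
        have g0 := hT.col' q hj
        have g3 : T (a + 1, q) < T (a, q + 1) := by
          rcases onp_next hl ha' with ⟨_, g, _⟩ | ⟨_, g⟩
          · exact g
          · rw [show a + q + 1 = a + 1 + q by omega, hq] at g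
            simp at g
        refine ⟨T (a + 1, q) - 1, by omega, ?_⟩
        simp only [Nat.sub_add_cancel hpos]
        rw [hh_one ha' g0.le, hT.cnt_at hj le_rfl (hT.row' q hj),
          hT.cnt_at (i := a) (by omega) g0.le g3]
        ring
      · subst ha
        have := hT.row' a hj
        exact absurd ⟨ha', by omega⟩ (hmin a (by omega))

theorem link_dd (hl : 1 ≤ l) (hT : IsSYT (l : ℕ∞) T) (j : ℕ) (hj : j < l) : ∀ i m,
    dd j (shf (cz T)) i m =
      if i < j then (cnt T i (m + 1) : ℤ) - hh l T i (m + 1) + hh l T (i + 1) (m + 1)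
      else if i = j then (cnt T i (m + 1) : ℤ) - hh l T i (m + 1)
      else (cnt T i (m + 1) : ℤ) := by
  induction j with
  | zero =>
    intro i m
    simp only [dd, shf, cz, cnt_one hT]
    by_cases h : i = 0
    · subst h; simp
      rw [hh_one onp_zero (by rw [hT.zz]; omega)]
    · simp [h]
  | succ j ih =>
    have ih := ih (by omega)
    have hR : ∀ m, rmax (fun s => dd j (shf (cz T)) (j + 1) s - dd j (shf (cz T)) j s) m
        = hh l T (j + 1) (m + 1) := by
      intro m
      rw [← hole_rmax hl hT hj m]
      congr 1
      funext s
      rw [ih, ih]; simp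
    intro i m
    simp only [dd]
    by_cases h1 : i = j
    · subst h1; rw [pit_self, hR, ih]; simp
    · by_cases h2 : i = j + 1
      · subst h2; rw [pit_succ, hR, ih]; simp
      · rw [pit_other _ _ _ _ h1 h2, ih]
        by_cases h3 : i < j
        · simp [h3, show i < j + 1 by omega]
        · simp [h1, h2, h3, show ¬ i < j + 1 by omega]

theorem link (hl : 1 ≤ l) (hT : IsSYT (l : ℕ∞) T) :
    cz (jdt (Box (l : ℕ∞)) T) = dd (l - 1) (shf (cz T)) := by
  funext i m
  rw [link_dd hl hT (l - 1) (by omega)]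
  unfold cz
  rw [link_cnt hl hT]
  have hz : ∀ i, l ≤ i → hh l T i (m + 1) = 0 := by
    intro i hi
    apply hh_zero
    intro j hj
    have := onp_row hl hj
    omega
  split_ifs with h1 h2
  · rfl
  · rw [hz (i + 1) (by omega)]; ring
  · rw [hz (i + 1) (by omega), hz i (by omega)]; ring

theorem isSYT_iter (hl : 1 ≤ l) (hT : IsSYT (l : ℕ∞) T) (N : ℕ) :
    IsSYT (l : ℕ∞) ((jdt (Box (l : ℕ∞)))^[N] T) := by
  induction N with
  | zero => exact hT
  | succ N ih => rw [Function.iterate_succ_apply']; exact isSYT_jdt hl ih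

theorem phi_iter (hl : 1 ≤ l) (N : ℕ) : ∀ {T : ℕ × ℕ → ℕ}, IsSYT (l : ℕ∞) T →
    phi (l - 1) (cz ((jdt (Box (l : ℕ∞)))^[N] T)) = phi (l - 1) (shf^[N] (cz T)) := by
  induction N with
  | zero => intro T hT; rfl
  | succ N ih =>
    intro T hT
    rw [Function.iterate_succ_apply, ih (isSYT_jdt hl hT), link hl hT,
      phi_shf_iter_dd (l - 1) (l - 1) le_rfl N (isWord_shf hT.cz_word), ← Function.iterate_succ_apply]

theorem jdt_eq_of_shf (hl : 1 ≤ l) (hT : IsSYT (l : ℕ∞) T) (N M : ℕ)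
    (h : shf^[N] (cz T) = shf^[M] (cz T)) :
    (jdt (Box (l : ℕ∞)))^[N] T = (jdt (Box (l : ℕ∞)))^[M] T := by
  have h1 := isSYT_iter hl hT N
  have h2 := isSYT_iter hl hT M
  have e := phi_iter hl N hT
  rw [h, ← phi_iter hl M hT,
    phi_fix _ h1.cz_word.1 (fun i m => by unfold cz; exact_mod_cast h1.cnt_lat i m),
    phi_fix _ h2.cz_word.1 (fun i m => by unfold cz; exact_mod_cast h2.cnt_lat i m)] at e
  refine h1.ext_cnt h2 (fun i m => ?_)
  have := congrFun (congrFun e i) m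
  unfold cz at this
  exact_mod_cast this

theorem shf_iter (x : ℕ → ℕ → ℤ) (N : ℕ) : ∀ i m, shf^[N] x i m = x i (m + N) - if N = 0 then 0 else x i N := by
  induction N with
  | zero => intro i m; simp
  | succ N ih =>
    intro i m
    rw [Function.iterate_succ_apply']
    simp only [shf, ih]
    rw [show m + 1 + N = m + (N + 1) by omega, show 1 + N = N + 1 by omega]
    simp

/-- backward direction -/
theorem jdt_of_periodic (hl : 1 ≤ l) (hT : IsSYT (l : ℕ∞) T) (n k : ℕ) (hn : 1 ≤ n)
    (h : ∀ i v, n < v → ((∃ j, T (i, j) = v) ↔ (∃ j, T (i, j) = v + k))) :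
    (jdt (Box (l : ℕ∞)))^[n + k] T = (jdt (Box (l : ℕ∞)))^[n] T := by
  apply jdt_eq_of_shf hl hT
  funext i m
  rw [shf_iter, shf_iter, if_neg (by omega), if_neg (by omega)]
  unfold cz
  induction m with
  | zero => simp
  | succ m ih =>
    rw [show m + 1 + (n + k) = m + (n + k) + 1 by omega, show m + 1 + n = m + n + 1 by omega]
    simp only [cnt]
    have := h i (m + n + 1) (by omega)
    rw [show m + n + 1 + k = m + (n + k) + 1 by omega] at this
    simp only [this]
    push_cast
    omega

theorem hh_ev (hl : 1 ≤ l) : ∃ V, ∀ m, V ≤ m → ∀ i, hh l T i m = hh l T i V := by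
  have : ∀ i, ∃ v, ∀ m, v ≤ m → hh l T i m = hh l T i v := by
    intro i
    by_cases h : ∃ j, onp l T i j
    · obtain ⟨j, hj⟩ := h
      exact ⟨T (i, j), fun m hm => by rw [hh_one hj hm, hh_one hj le_rfl]⟩
    · refine ⟨0, fun m _ => ?_⟩
      rw [hh_zero (fun j hj => absurd ⟨j, hj⟩ h), hh_zero (fun j hj => absurd ⟨j, hj⟩ h)]
  choose f hf using this
  refine ⟨(Finset.range l).sup f, fun m hm i => ?_⟩
  rcases Nat.lt_or_ge i l with hi | hi
  · have h1 : f i ≤ (Finset.range l).sup f := Finset.le_sup (Finset.mem_range.2 hi)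
    rw [hf i m (by omega), hf i _ h1]
  · have hz : ∀ m, hh l T i m = 0 := by
      intro m
      apply hh_zero
      intro j hj
      have := onp_row hl hj
      omega
    rw [hz, hz]

theorem row_ev (hl : 1 ≤ l) (hT : IsSYT (l : ℕ∞) T) : ∃ V, ∀ v, V < v → ∀ i,
    ((∃ j, jdt (Box (l : ℕ∞)) T (i, j) = v) ↔ ∃ j, T (i, j) = v + 1) := by
  obtain ⟨V, hV⟩ := hh_ev (T := T) hl
  refine ⟨V, fun v hv i => ?_⟩
  obtain ⟨m, rfl⟩ : ∃ m, v = m + 1 := ⟨v - 1, by omega⟩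
  have h1 := link_cnt hl hT m i
  have h2 := link_cnt hl hT (m + 1) i
  have e1 := hV (m + 1) (by omega)
  have e2 := hV (m + 1 + 1) (by omega)
  rw [e1, e1] at h1
  rw [e2, e2] at h2
  simp only [cnt] at h1 h2
  by_cases a : ∃ j, jdt (Box (l : ℕ∞)) T (i, j) = m + 1 <;>
    by_cases b : ∃ j, T (i, j) = m + 1 + 1 <;>
    simp only [a, b, if_true, if_false] at h1 h2 ⊢ <;> push_cast at h1 h2 <;> omega

theorem row_ev_iter (hl : 1 ≤ l) (hT : IsSYT (l : ℕ∞) T) (N : ℕ) : ∃ V, ∀ v, V < v → ∀ i,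
    ((∃ j, (jdt (Box (l : ℕ∞)))^[N] T (i, j) = v) ↔ ∃ j, T (i, j) = v + N) := by
  induction N with
  | zero => exact ⟨0, fun v _ i => Iff.rfl⟩
  | succ N ih =>
    obtain ⟨V, hV⟩ := ih
    obtain ⟨W, hW⟩ := row_ev hl (isSYT_iter hl hT N)
    refine ⟨V + W, fun v hv i => ?_⟩
    rw [Function.iterate_succ_apply', hW v (by omega), hV (v + 1) (by omega),
      show v + 1 + N = v + (N + 1) by omega]

theorem periodic_of_jdt (hl : 1 ≤ l) (hT : IsSYT (l : ℕ∞) T) (N k : ℕ)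
    (h : (jdt (Box (l : ℕ∞)))^[N + k] T = (jdt (Box (l : ℕ∞)))^[N] T) :
    ∃ n, 1 ≤ n ∧ ∀ i v, n < v → ((∃ j, T (i, j) = v) ↔ (∃ j, T (i, j) = v + k)) := by
  obtain ⟨V, hV⟩ := row_ev_iter hl hT N
  obtain ⟨W, hW⟩ := row_ev_iter hl hT (N + k)
  refine ⟨V + W + N + 1, by omega, fun i v hv => ?_⟩
  have h1 := hV (v - N) (by omega) i
  have h2 := hW (v - N) (by omega) i
  rw [h, h1, show v - N + N = v by omega, show v - N + (N + k) = v + k by omega] at h2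
  exact h2

theorem ncard_level (hT : IsSYT (l : ℕ∞) T) (a b : ℕ) (P : ℕ × ℕ → Prop)
    (hP : ∀ i j, P (i, j) ↔ a < T (i, j) ∧ T (i, j) ≤ b) :
    {c : ℕ × ℕ | P c}.Finite ∧ {c : ℕ × ℕ | P c}.ncard = b - a := by
  have hb : ∀ c : ℕ × ℕ, 0 < T c → c.1 < l := by
    rintro ⟨i, j⟩ hc
    by_contra h
    rw [hT.out j (by simpa using h)] at hc
    omega
  have hinj : Set.InjOn T {c : ℕ × ℕ | P c} := by
    rintro ⟨i, j⟩ hc c' _ e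
    have := (hP i j).1 hc
    exact hT.inj' (hb _ (by omega)) e
  have himg : T '' {c : ℕ × ℕ | P c} = Finset.Ioc a b := by
    ext v
    simp only [Set.mem_image, Set.mem_ofPred_eq, Finset.coe_Ioc, Set.mem_Ioc]
    constructor
    · rintro ⟨⟨i, j⟩, hc, rfl⟩; exact (hP i j).1 hc
    · intro hv
      obtain ⟨i, j, _, e⟩ := hT.surj' v (by omega)
      exact ⟨(i, j), (hP i j).2 (by omega), e⟩
  constructor
  · apply Set.Finite.of_finite_image _ hinj
    rw [himg]; exact Finset.finite_toSet _
  · rw [← hinj.ncard_image, himg, Set.ncard_coe_finset, Nat.card_Ioc]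

theorem smash_of_periodic (hl : 1 ≤ l) (hT : IsSYT (l : ℕ∞) T) (n k : ℕ) (hn : 1 ≤ n) (hk : 1 ≤ k)
    (h : ∀ i v, n < v → ((∃ j, T (i, j) = v) ↔ (∃ j, T (i, j) = v + k))) :
    (∃ (nu lamh : ℕ → ℕ) (S : ℕ × ℕ → ℕ) (n : ℕ) (lam : ℕ → ℕ) (B : ℕ × ℕ → ℕ),
      IsSkewShape nu lamh k ∧ WeaklyDecreasing nu lamh ∧ SkewHeight nu lamh l ∧
      IsSkewSYT nu lamh k S ∧ 1 ≤ n ∧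
      IsPartition lam n ∧ (∀ i : ℕ, l ≤ i → lam i = 0) ∧ IsFinSYT lam n B ∧
      BSstandard l n lam nu lamh B S ∧
      T = smashInf (l : ℕ∞) n k lam B nu lamh S) := by
  -- periodicity of counts
  have hper : ∀ i m, cnt T i (n + m + k) = cnt T i (n + m) + (cnt T i (n + k) - cnt T i n) := by
    intro i m
    have hmn := cnt_mono T i (show n ≤ n + k by omega)
    induction m with
    | zero => simp only [Nat.add_zero]; omega
    | succ m ih =>
      rw [show n + (m + 1) + k = n + m + k + 1 by omega, show n + (m + 1) = n + m + 1 by omega]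
      simp only [cnt]
      have := h i (n + m + 1) (by omega)
      rw [show n + m + 1 + k = n + m + k + 1 by omega] at this
      simp only [this]
      omega
  have hperc : ∀ i c, cnt T i (n + c * k) = cnt T i n + c * (cnt T i (n + k) - cnt T i n) := by
    intro i c
    induction c with
    | zero => simp
    | succ c ih =>
      rw [show n + (c + 1) * k = n + c * k + k by ring, hper, ih]; ring
  have hskew : ∀ i j, SkewBox (fun i => cnt T i n) (fun i => cnt T i (n + k)) (i, j) ↔
      n < T (i, j) ∧ T (i, j) ≤ n + k := by
    intro i j
    simp only [SkewBox]
    rcases Nat.lt_or_ge i l with hi | hi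
    · rw [hT.lt_cnt hi, ← not_lt, ← hT.lt_cnt hi, not_le]
    · rw [hT.cnt_out hi, hT.cnt_out hi, hT.out j hi]; omega
  have hyb : ∀ i j, YBox (fun i => cnt T i n) (i, j) ↔ 0 < T (i, j) ∧ T (i, j) ≤ n := by
    intro i j
    simp only [YBox]
    rcases Nat.lt_or_ge i l with hi | hi
    · have := hT.pos' j hi
      rw [← hT.lt_cnt hi]; omega
    · rw [hT.cnt_out hi, hT.out j hi]; omega
  have hlt : ∀ i j, 0 < T (i, j) → i < l := by
    intro i j hp
    by_contra hc
    rw [hT.out j (by omega)] at hp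
    omega
  have hwd : ∀ i, cnt T (i + 1) (n + k) - cnt T (i + 1) n ≤ cnt T i (n + k) - cnt T i n := by
    intro i
    by_contra hc
    push Not at hc
    have h1 := hT.cnt_lat i (n + (cnt T i n + 1) * k)
    rw [hperc, hperc] at h1
    have h2 : (cnt T i n + 1) * (cnt T i (n + k) - cnt T i n + 1) ≤
      (cnt T i n + 1) * (cnt T (i + 1) (n + k) - cnt T (i + 1) n) := Nat.mul_le_mul_left _ hc
    rw [Nat.mul_add] at h2
    omega
  have hgrow : ∀ i, i < l → cnt T i n < cnt T i (n + k) := by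
    intro i hi
    by_contra hc
    have hz : cnt T i (n + k) - cnt T i n = 0 := by omega
    have h1 := hperc i (T (i, cnt T i n))
    rw [hz, Nat.mul_zero, Nat.add_zero] at h1
    have h2 := (hT.lt_cnt hi (n + T (i, cnt T i n) * k) (cnt T i n)).1 (by nlinarith)
    omega
  obtain ⟨f1, c1⟩ := ncard_level hT n (n + k) _ hskew
  obtain ⟨f2, c2⟩ := ncard_level hT 0 n _ hyb
  refine ⟨fun i => cnt T i n, fun i => cnt T i (n + k),
    fun b => if n < T b ∧ T b ≤ n + k then T b - n else 0, n, fun i => cnt T i n,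
    fun b => if T b ≤ n then T b else 0, ?_, ?_, ?_, ?_, hn, ?_, ?_, ?_, ?_, ?_⟩
  · exact ⟨fun i => hT.cnt_lat i n, fun i => hT.cnt_lat i (n + k),
      fun i => cnt_mono T i (by omega), f1, by rw [c1]; omega⟩
  · exact hwd
  · exact ⟨hgrow (l - 1) (by omega), fun i hi => by simp only [hT.cnt_out hi]⟩
  · refine ⟨?_, ?_, ?_, ?_, ?_, ?_, ?_⟩
    · rintro ⟨i, j⟩ hb
      rw [hskew] at hb
      exact if_neg hb
    · rintro ⟨i, j⟩ hb
      rw [hskew] at hb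
      simp only [if_pos hb]; omega
    · rintro ⟨i, j⟩ hb
      rw [hskew] at hb
      simp only [if_pos hb]; omega
    · rintro ⟨i, j⟩ ⟨i', j'⟩ hb hc e
      rw [hskew] at hb hc
      simp only [if_pos hb, if_pos hc] at e
      exact hT.inj' (b := (i, j)) (hlt i j (by omega)) (by omega)
    · intro m h1 h2
      obtain ⟨i, j, _, e⟩ := hT.surj' (m + n) (by omega)
      refine ⟨(i, j), (hskew i j).2 (by omega), ?_⟩
      simp only [e]; rw [if_pos (by omega)]; omega
    · rintro ⟨i, j⟩ hb hc
      simp only at hc ⊢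
      rw [hskew] at hb hc
      rw [if_pos hb, if_pos hc]
      have := hT.row' j (hlt i j (by omega))
      omega
    · rintro ⟨i, j⟩ hb hc
      simp only at hc ⊢
      rw [hskew] at hb hc
      rw [if_pos hb, if_pos hc]
      have := hT.col' j (hlt (i + 1) j (by omega))
      omega
  · exact ⟨fun i => hT.cnt_lat i n, f2, by rw [c2]; omega⟩
  · exact fun i hi => hT.cnt_out hi n
  · refine ⟨?_, ?_, ?_, ?_, ?_, ?_, ?_⟩
    · rintro ⟨i, j⟩ hb
      rw [hyb] at hb
      split_ifs <;> omega
    · rintro ⟨i, j⟩ hb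
      rw [hyb] at hb
      simp only [if_pos hb.2]; omega
    · rintro ⟨i, j⟩ hb
      rw [hyb] at hb
      simp only [if_pos hb.2]; omega
    · rintro ⟨i, j⟩ ⟨i', j'⟩ hb hc e
      rw [hyb] at hb hc
      simp only [if_pos hb.2, if_pos hc.2] at e
      exact hT.inj' (b := (i, j)) (hlt i j (by omega)) (by omega)
    · intro m h1 h2
      obtain ⟨i, j, _, e⟩ := hT.surj' m (by omega)
      refine ⟨(i, j), (hyb i j).2 (by omega), ?_⟩
      simp only [e]; rw [if_pos (by omega)]
    · rintro ⟨i, j⟩ hc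
      simp only at hc ⊢
      rw [hyb] at hc
      have := hT.row' j (hlt i _ hc.1)
      rw [if_pos hc.2, if_pos (by omega)]
      omega
    · rintro ⟨i, j⟩ hc
      simp only at hc ⊢
      rw [hyb] at hc
      have := hT.col' j (hlt (i + 1) _ hc.1)
      rw [if_pos hc.2, if_pos (by omega)]
      omega
  · have hF : ∀ i j, i < l → j < cnt T i (n + k) →
        (if j < cnt T i n then (if T (i, j) ≤ n then T (i, j) else 0)
          else (if n < T (i, cnt T i n + (j - cnt T i n)) ∧
            T (i, cnt T i n + (j - cnt T i n)) ≤ n + k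
            then T (i, cnt T i n + (j - cnt T i n)) - n else 0) + n) = T (i, j) := by
      intro i j hi hj
      have a1 := hT.lt_cnt hi n j
      have a2 := hT.lt_cnt hi (n + k) j
      by_cases h1 : j < cnt T i n
      · rw [if_pos h1, if_pos (a1.2 h1)]
      · rw [if_neg h1, Nat.add_sub_cancel' (by omega), if_pos (by omega)]
        omega
    have hm : ∀ i j, j < (if i < l then cnt T i n + (cnt T i (n + k) - cnt T i n) else 0) →
        i < l ∧ j < cnt T i (n + k) := by
      intro i j hj
      have := cnt_mono T i (show n ≤ n + k by omega)
      split_ifs at hj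
      · exact ⟨by assumption, by omega⟩
      · omega
    refine ⟨fun i j hj => ?_, fun i j hj hj' => ?_⟩
    · obtain ⟨hi, h1⟩ := hm i _ hj
      simp only
      rw [hF i j hi (by omega), hF i (j + 1) hi h1]
      exact hT.row' j hi
    · obtain ⟨hi, h1⟩ := hm i _ hj
      obtain ⟨hi', h1'⟩ := hm (i + 1) _ hj'
      simp only
      rw [hF i j hi h1, hF (i + 1) j hi' h1']
      exact hT.col' j hi'
  · funext ⟨i, j⟩
    simp only [smashInf, box_iff]
    by_cases hi : i < l
    swap
    · rw [if_neg hi, hT.out j (by omega)]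
    rw [if_pos hi]
    by_cases h1 : j < cnt T i n
    · rw [if_pos h1, if_pos ((hT.lt_cnt hi n j).2 h1)]
    rw [if_neg h1]
    have hg := hgrow i hi
    obtain ⟨s, hs⟩ : ∃ s, cnt T i (n + k) = cnt T i n + s := ⟨cnt T i (n + k) - cnt T i n, by omega⟩
    have hper' := hper i
    rw [hs, Nat.add_sub_cancel_left] at hper' ⊢
    have hsh : ∀ j, cnt T i n ≤ j → T (i, j + s) = T (i, j) + k := by
      intro j hj
      have a1 := hT.lt_cnt hi n j
      have a2 := hT.lt_cnt hi (n + k) (j + s)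
      apply le_antisymm
      · obtain ⟨m, hm⟩ : ∃ m, T (i, j) = n + m := ⟨T (i, j) - n, by omega⟩
        rw [hm, hT.lt_cnt hi, hper']
        have := (hT.lt_cnt hi (n + m) j).1 (by omega)
        omega
      · obtain ⟨m, hm⟩ : ∃ m, T (i, j + s) = n + m + k := ⟨T (i, j + s) - n - k, by omega⟩
        have := (hT.lt_cnt hi (n + m + k) (j + s)).1 (by omega)
        rw [hper'] at this
        have := (hT.lt_cnt hi (n + m) j).2 (by omega)
        omega
    have hshq : ∀ q r, T (i, cnt T i n + r + q * s) = T (i, cnt T i n + r) + q * k := by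
      intro q r
      induction q with
      | zero => simp
      | succ q ih =>
        rw [show cnt T i n + r + (q + 1) * s = cnt T i n + r + q * s + s by ring,
          hsh _ (by rw [Nat.add_assoc]; exact Nat.le_add_right _ _), ih]
        ring
    have hspos : 0 < s := by omega
    have hr := Nat.mod_lt (j - cnt T i n) hspos
    have hdm := Nat.mod_add_div (j - cnt T i n) s
    have key := hshq ((j - cnt T i n) / s) ((j - cnt T i n) % s)
    rw [show cnt T i n + (j - cnt T i n) % s + (j - cnt T i n) / s * s = j by
      rw [Nat.mul_comm, Nat.add_assoc, hdm]; omega] at key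
    have a1 := hT.lt_cnt hi n (cnt T i n + (j - cnt T i n) % s)
    have a2 := hT.lt_cnt hi (n + k) (cnt T i n + (j - cnt T i n) % s)
    rw [if_pos (by omega), key]
    omega
end tab

theorem row_of_smash (l n k : ℕ) (nu lamh lam : ℕ → ℕ) (S B T : ℕ × ℕ → ℕ) (hl : 1 ≤ l)
    (hT : IsSYT (l : ℕ∞) T)
    (hw : WeaklyDecreasing nu lamh) (hh : SkewHeight nu lamh l) (hS : IsSkewSYT nu lamh k S)
    (hB : IsFinSYT lam n B)
    (e : T = smashInf (l : ℕ∞) n k lam B nu lamh S) (i v : ℕ) (hv : n < v) :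
    (∃ j, T (i, j) = v) ↔ (∃ j, T (i, j) = v + k) := by
  rcases Nat.lt_or_ge i l with hi | hi
  swap
  · constructor
    · rintro ⟨j, hj⟩; rw [hT.out j hi] at hj; omega
    · rintro ⟨j, hj⟩; rw [hT.out j hi] at hj; omega
  have hpos : 0 < lamh i - nu i := by
    have : ∀ d, d ≤ l - 1 → 0 < lamh (l - 1 - d) - nu (l - 1 - d) := by
      intro d
      induction d with
      | zero => intro _; have := hh.1; simp only [Nat.sub_zero]; omega
      | succ d ih =>
        intro hd
        have h1 := ih (by omega)
        have h2 := hw (l - 1 - (d + 1))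
        rw [show l - 1 - (d + 1) + 1 = l - 1 - d by omega] at h2
        omega
    have := this (l - 1 - i) (by omega)
    rwa [show l - 1 - (l - 1 - i) = i by omega] at this
  have hlo : ∀ j, j < lam i → T (i, j) ≤ n := by
    intro j hj
    rw [e]
    simp only [smashInf, box_iff, hi, hj, if_true]
    exact hB.ub _ hj
  have hhi : ∀ u, T (i, lam i + u) = S (i, nu i + u % (lamh i - nu i)) + n
      + (u / (lamh i - nu i)) * k := by
    intro u
    rw [e]
    simp only [smashInf, box_iff, hi, if_true]
    rw [if_neg (by omega), Nat.add_sub_cancel_left]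
  have hshift : ∀ u, T (i, lam i + (u + (lamh i - nu i))) = T (i, lam i + u) + k := by
    intro u
    rw [hhi, hhi, Nat.add_mod_right, Nat.add_div_right _ hpos]
    ring
  constructor
  · rintro ⟨j, hj⟩
    have h1 : lam i ≤ j := by
      by_contra hc
      have := hlo j (by omega)
      omega
    have := hshift (j - lam i)
    rw [Nat.add_sub_cancel' h1, hj] at this
    exact ⟨_, this⟩
  · rintro ⟨j, hj⟩
    have h1 : lam i ≤ j := by
      by_contra hc
      have := hlo j (by omega)
      omega
    have h2 : lamh i - nu i ≤ j - lam i := by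
      by_contra hc
      have h3 := hhi (j - lam i)
      rw [Nat.add_sub_cancel' h1, hj, Nat.mod_eq_of_lt (by omega), Nat.div_eq_of_lt (by omega)] at h3
      have := hS.ub (i, nu i + (j - lam i)) ⟨by simp, by simp only; omega⟩
      omega
    have := hshift (j - lam i - (lamh i - nu i))
    rw [Nat.sub_add_cancel h2, Nat.add_sub_cancel' h1, hj] at this
    exact ⟨_, (Nat.add_right_cancel this).symm⟩
/-- `T ∈ SYT((∞^l))` is `k`-pre-periodic (some iterate of `T` under jeu de taquin
is `k`-periodic) iff `T` is the iterated left smash `B ◁ S ◁ S ◁ ⋯` of a standard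
Young tableau `B` of some shape `lam ⊢ n` with at most `l` rows with infinitely
many copies of a standard skew Young tableau `S` whose (weakly decreasing) skew
shape `λ̂/ν` is contained in `(∞^l)` and satisfies `ℓ(λ̂/ν) = l` and `|λ̂/ν| = k`,
such that `B ◁ S` is a standard filling. -/
theorem stmt_13 (l k : ℕ) (hl : 1 ≤ l) (hk : 1 ≤ k)
    (T : ℕ × ℕ → ℕ) (hT : IsSYT (l : ℕ∞) T) :
    (∃ N : ℕ, 1 ≤ N ∧
        (jdt (Box (l : ℕ∞)))^[N + k] T = (jdt (Box (l : ℕ∞)))^[N] T) ↔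
    (∃ (nu lamh : ℕ → ℕ) (S : ℕ × ℕ → ℕ) (n : ℕ) (lam : ℕ → ℕ) (B : ℕ × ℕ → ℕ),
      IsSkewShape nu lamh k ∧ WeaklyDecreasing nu lamh ∧ SkewHeight nu lamh l ∧
      IsSkewSYT nu lamh k S ∧ 1 ≤ n ∧
      IsPartition lam n ∧ (∀ i : ℕ, l ≤ i → lam i = 0) ∧ IsFinSYT lam n B ∧
      BSstandard l n lam nu lamh B S ∧
      T = smashInf (l : ℕ∞) n k lam B nu lamh S) := by
  constructor
  · rintro ⟨N, _, h⟩
    obtain ⟨n, hn, hp⟩ := periodic_of_jdt hl hT N k h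
    exact smash_of_periodic hl hT n k hn hk hp
  · rintro ⟨nu, lamh, S, n, lam, B, _, hw, hh, hS, hn, _, _, hB, _, e⟩
    exact ⟨n, hn, jdt_of_periodic hl hT n k hn
      (row_of_smash l n k nu lamh lam S B T hl hT hw hh hS hB e)⟩
end

section
/- Let μ be the infinite shape (∞^l) for some l ≥ 1 or the infinite shape (∞^∞). Then the function d(T,U) = Σ_{(i,j) ∈ μ, T_{i,j} ≠ U_{i,j}} 2^{−(i+j)} is a well-defined metric on SYT(μ), and with respect to this metric the map jdt : SYT(μ) → SYT(μ) is uniformly continuous. -/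
open scoped Classical

/-- The metric `d(T, U) = Σ_{(i,j) : T_{i,j} ≠ U_{i,j}} 2^{-(i+j)}` (1-based
indices in the exponent, so the 0-based box `b` contributes `2^{-(b.1+b.2+2)}`). -/
noncomputable def dSYT (T U : ℕ × ℕ → ℕ) : ℝ :=
  ∑' b : ℕ × ℕ, if T b ≠ U b then ((2 : ℝ) ^ (b.1 + b.2 + 2))⁻¹ else 0

theorem wt_summable : Summable (fun b : ℕ × ℕ => ((2 : ℝ) ^ (b.1 + b.2 + 2))⁻¹) := by
  have h : Summable (fun n : ℕ => ((1 : ℝ) / 2) ^ n) := summable_geometric_two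
  have h2 := (h.mul_of_nonneg h (fun n => by positivity) (fun n => by positivity)).mul_left (1/4 : ℝ)
  refine h2.congr (fun b => ?_)
  simp only [pow_add, one_div, inv_pow, mul_inv]
  ring

theorem d_summable (T U : ℕ × ℕ → ℕ) :
    Summable (fun b : ℕ × ℕ => if T b ≠ U b then ((2 : ℝ) ^ (b.1 + b.2 + 2))⁻¹ else 0) := by
  refine Summable.of_nonneg_of_le (fun b => ?_) (fun b => ?_) wt_summable
  · split_ifs <;> positivity
  · split_ifs
    · exact le_rfl
    · positivity

theorem d_term_le (T U : ℕ × ℕ → ℕ) (b : ℕ × ℕ) (h : T b ≠ U b) :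
    ((2 : ℝ) ^ (b.1 + b.2 + 2))⁻¹ ≤ dSYT T U := by
  have := (d_summable T U).le_tsum b (fun c _ => by split_ifs <;> positivity)
  rw [if_pos h] at this
  exact this

theorem slide_sum_le (D : ℕ × ℕ → Prop) (T : ℕ × ℕ → ℕ) (n : ℕ) :
    (slide D T n).1 + (slide D T n).2 ≤ n := by
  induction n with
  | zero => simp [slide, slideFrom]
  | succ n ih =>
    simp only [slide] at ih ⊢
    simp only [slideFrom]
    split_ifs <;> grind

theorem slide_congr (D : ℕ × ℕ → Prop) (T U : ℕ × ℕ → ℕ) (M : ℕ)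
    (h : ∀ b : ℕ × ℕ, b.1 + b.2 ≤ M → T b = U b) (n : ℕ) (hn : n ≤ M) :
    slide D T n = slide D U n := by
  induction n with
  | zero => rfl
  | succ n ih =>
    have ih := ih (by omega)
    have hs := slide_sum_le D U n
    simp only [slide] at ih hs ⊢
    simp only [slideFrom]
    rw [ih, h (_ + 1, _) (by simp only []; omega), h (_, _ + 1) (by simp only []; omega)]

theorem jdt_congr (D : ℕ × ℕ → Prop) (T U : ℕ × ℕ → ℕ) (M : ℕ)
    (h : ∀ b : ℕ × ℕ, b.1 + b.2 ≤ M + 1 → T b = U b) (b : ℕ × ℕ) (hb : b.1 + b.2 ≤ M) :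
    jdt D T b = jdt D U b := by
  have hs := slide_sum_le D U (b.1 + b.2 + 1)
  simp only [jdt]
  rw [slide_congr D T U (M + 1) h _ (by omega), slide_congr D T U (M + 1) h (b.1 + b.2 + 1) (by omega),
    h b (by omega), h (slide D U (b.1 + b.2 + 1)) (by omega)]

/-- Let `μ` be `(∞^l)` for some `l ≥ 1` or `(∞^∞)`.  Then `dSYT` is a metric on
`SYT(μ)` (nonnegative, vanishing exactly on the diagonal, symmetric, and
satisfying the triangle inequality), and jeu de taquin is uniformly continuous on
`SYT(μ)` with respect to it. -/
theorem stmt_14 (l : ℕ∞) (hl : l = ⊤ ∨ ∃ l₀ : ℕ, 1 ≤ l₀ ∧ l = (l₀ : ℕ∞)) :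
    (∀ T U : ℕ × ℕ → ℕ, IsSYT l T → IsSYT l U → 0 ≤ dSYT T U) ∧
    (∀ T U : ℕ × ℕ → ℕ, IsSYT l T → IsSYT l U → (dSYT T U = 0 ↔ T = U)) ∧
    (∀ T U : ℕ × ℕ → ℕ, IsSYT l T → IsSYT l U → dSYT T U = dSYT U T) ∧
    (∀ T U V : ℕ × ℕ → ℕ, IsSYT l T → IsSYT l U → IsSYT l V →
      dSYT T V ≤ dSYT T U + dSYT U V) ∧
    (∀ ε : ℝ, 0 < ε → ∃ δ : ℝ, 0 < δ ∧ ∀ T U : ℕ × ℕ → ℕ, IsSYT l T → IsSYT l U →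
      dSYT T U < δ → dSYT (jdt (Box l) T) (jdt (Box l) U) < ε) := by
  refine ⟨fun T U _ _ => ?_, fun T U _ _ => ⟨fun h => ?_, fun h => ?_⟩, fun T U _ _ => ?_,
    fun T U V _ _ _ => ?_, fun ε hε => ?_⟩
  · exact tsum_nonneg (fun b => by split_ifs <;> positivity)
  · funext b
    by_contra hb
    have h1 := d_term_le T U b hb
    have h2 : (0 : ℝ) < ((2 : ℝ) ^ (b.1 + b.2 + 2))⁻¹ := by positivity
    linarith
  · subst h
    simp [dSYT]
  · simp only [dSYT, ne_comm]
  · unfold dSYT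
    rw [← (d_summable T U).tsum_add (d_summable U V)]
    refine (d_summable T V).tsum_le_tsum (fun b => ?_) ((d_summable T U).add (d_summable U V))
    have h2 : (0 : ℝ) < ((2 : ℝ) ^ (b.1 + b.2 + 2))⁻¹ := by positivity
    by_cases h3 : T b = U b
    · simp [h3]
    · rw [if_pos h3]
      split_ifs <;> linarith
  · have hw := wt_summable
    obtain ⟨s, hs⟩ := ((hw.hasSum).eventually (lt_mem_nhds
      (show (∑' b : ℕ × ℕ, ((2 : ℝ) ^ (b.1 + b.2 + 2))⁻¹) - ε < _ by linarith))).exists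
    let M := s.sup (fun b => b.1 + b.2)
    refine ⟨((2 : ℝ) ^ (M + 1 + 2))⁻¹, by positivity, fun T U _ _ hd => ?_⟩
    have h : ∀ b : ℕ × ℕ, b.1 + b.2 ≤ M + 1 → T b = U b := by
      intro b hb
      by_contra hne
      have h1 := d_term_le T U b hne
      have h2 : ((2 : ℝ) ^ (M + 1 + 2))⁻¹ ≤ ((2 : ℝ) ^ (b.1 + b.2 + 2))⁻¹ := by
        apply inv_anti₀ (by positivity)
        exact pow_le_pow_right₀ (by norm_num) (by omega)
      linarith
    have hj : ∀ b ∈ s, jdt (Box l) T b = jdt (Box l) U b := fun b hb =>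
      jdt_congr (Box l) T U M h b (Finset.le_sup (f := fun b : ℕ × ℕ => b.1 + b.2) hb)
    have e1 := (d_summable (jdt (Box l) T) (jdt (Box l) U)).sum_add_tsum_compl (s := s)
    have e2 := hw.sum_add_tsum_compl (s := s)
    rw [Finset.sum_eq_zero (fun b hb => if_neg (not_not.2 (hj b hb))), zero_add] at e1
    have e3 := ((d_summable (jdt (Box l) T) (jdt (Box l) U)).subtype ((s : Set (ℕ × ℕ))ᶜ)).tsum_le_tsum
      (fun b => by
        simp only [Function.comp]
        split_ifs
        · exact le_rfl
        · positivity) (hw.subtype ((s : Set (ℕ × ℕ))ᶜ))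
    simp only [Function.comp_def] at e3
    have e4 := e1.symm.le.trans (e3.trans (eq_sub_of_add_eq' e2).le)
    simp only [] at hs
    unfold dSYT
    linarith
end
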